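/- arXiv:math/0404112 — 2 statements merged into one kernel-verified Lean document; each statement's English description precedes it below -/
import Mathlib

section
/- Let q ≥ 1 and h be integers, let ℐ and 𝒥 be intervals of real numbers, and let f : ℐ × 𝒥 → ℝ be a C¹ function. Then for every integer T > 1 and every δ > 0, Σ_{a ∈ ℐ∩ℤ, b ∈ 𝒥∩ℤ, ab ≡ h (mod q), gcd(b,q)=1} f(a,b) = (φ(q)/q²)·∬_{ℐ×𝒥} f(x,y) dx dy + O_δ( (1+|ℐ|/q)(1+|𝒥|/q)·T²·‖f‖_∞·q^{1/2+δ}·gcd(h,q) + (1+|ℐ|/q)(1+|𝒥|/q)·T·‖Df‖_∞·q^{3/2+δ}·gcd(h,q) + |ℐ|·|𝒥|·‖Df‖_∞/T ), where the implied constant depends only on δ. -/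
/-- The Kloosterman sum `∑ Ψ(a u + b u⁻¹)` over the units of a finite ring. -/
noncomputable def kloostermanSum {R : Type*} [CommRing R] [Fintype Rˣ] (Ψ : AddChar R ℂ)
    (a b : R) : ℂ :=
  ∑ u : Rˣ, Ψ (a * u + b * (↑u⁻¹ : R))

section QuadraticExtension

open Finset

variable {F : Type*} [Field F] [Fintype F] [DecidableEq F]

lemma card_pairs_add_card_conj_le {L : Type*} [Field L] [Fintype L] [Algebra F L]
    (T N : L → F)
    (hT : ∀ x, algebraMap F L (T x) = x + x ^ Fintype.card F)
    (hN : ∀ x, algebraMap F L (N x) = x * x ^ Fintype.card F) (uv : F × F) :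
    #{xy : F × F | (xy.1 + xy.2, xy.1 * xy.2) = uv} + #{x : L | (T x, N x) = uv} ≤ 2 := by
  classical
  obtain ⟨u, v⟩ := uv
  have inj := (algebraMap F L).injective
  have hF : ∀ x : F, (algebraMap F L x) ^ Fintype.card F = algebraMap F L x := fun x ↦ by
    rw [← map_pow, FiniteField.pow_card]
  by_cases h : ∃ x y : F, x + y = u ∧ x * y = v
  · obtain ⟨x, y, rfl, rfl⟩ := h
    have h1 : ({xy : F × F | (xy.1 + xy.2, xy.1 * xy.2) = (x + y, x * y)} : Finset _) ⊆
        {(x, y), (y, x)} := by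
      intro z hz
      simp only [mem_filter, mem_univ, true_and, Prod.mk.injEq, mem_insert, mem_singleton] at hz ⊢
      obtain ⟨z1, z2⟩ := z
      simp only at hz
      have : (z1 - x) * (z1 - y) = 0 := by
        have : z2 = x + y - z1 := by linear_combination hz.1
        rw [this] at hz
        linear_combination -hz.2
      rcases mul_eq_zero.mp this with h | h
      · left
        have := sub_eq_zero.mp h
        simp only [Prod.mk.injEq]
        exact ⟨this, by linear_combination hz.1 - this⟩
      · right
        have := sub_eq_zero.mp h
        simp only [Prod.mk.injEq]
        exact ⟨this, by linear_combination hz.1 - this⟩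
    have key : ∀ z : L, (T z, N z) = (x + y, x * y) → z = algebraMap F L x ∧ x = y := by
      intro z hz
      simp only [Prod.mk.injEq] at hz
      have e1 := hT z
      have e2 := hN z
      rw [hz.1, map_add] at e1
      rw [hz.2, map_mul] at e2
      have e3 : (z - algebraMap F L x) * (z - algebraMap F L y) = 0 := by
        linear_combination (-z) * e1 + e2
      have : ∀ w w' : F, w + w' = x + y → z = algebraMap F L w → w = w' := by
        intro w w' hw hz
        apply inj
        rw [hz, hF] at e1
        have := congrArg (algebraMap F L) hw
        simp only [map_add] at this
        linear_combination -e1 - this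
      rcases mul_eq_zero.mp e3 with h | h
      · have := this x y rfl (sub_eq_zero.mp h)
        exact ⟨sub_eq_zero.mp h, this⟩
      · have := this y x (add_comm _ _) (sub_eq_zero.mp h)
        exact ⟨this ▸ sub_eq_zero.mp h, this.symm⟩
    by_cases hxy : x = y
    · have c1 := card_le_card h1
      have c2 : #{z : L | (T z, N z) = (x + y, x * y)} ≤ #{algebraMap F L x} := by
        apply card_le_card
        intro z hz
        simpa using (key z (by simpa using hz)).1
      subst hxy
      simp only [insert_eq_of_mem, mem_singleton, card_singleton] at c1 c2
      omega
    · have c1 := (card_le_card h1).trans card_le_two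
      have c2 : #{z : L | (T z, N z) = (x + y, x * y)} = 0 := by
        rw [card_eq_zero, filter_eq_empty_iff]
        intro z _ hz
        exact hxy (key z hz).2
      omega
  · have c1 : #{xy : F × F | (xy.1 + xy.2, xy.1 * xy.2) = (u, v)} = 0 := by
      rw [card_eq_zero, filter_eq_empty_iff]
      rintro ⟨x, y⟩ _ hz
      simp only [Prod.mk.injEq] at hz
      exact h ⟨x, y, hz⟩
    rw [c1, zero_add]
    rcases ({x : L | (T x, N x) = (u, v)} : Finset L).eq_empty_or_nonempty with h0 | ⟨z, hz⟩
    · rw [h0]; simp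
    · refine (card_le_card (t := {z, algebraMap F L u - z}) ?_).trans card_le_two
      intro w hw
      simp only [mem_filter, mem_univ, true_and, Prod.mk.injEq, mem_insert, mem_singleton]
        at hz hw ⊢
      have e1 := hT z
      have e2 := hN z
      have e3 := hT w
      have e4 := hN w
      rw [hz.1] at e1
      rw [hz.2] at e2
      rw [hw.1] at e3
      rw [hw.2] at e4
      have : (w - z) * (w - (algebraMap F L u - z)) = 0 := by
        linear_combination z * e1 - e2 - w * e3 + e4
      rcases mul_eq_zero.mp this with h | h
      · exact Or.inl (sub_eq_zero.mp h)
      · exact Or.inr (sub_eq_zero.mp h)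

lemma card_pairs_add_card_conj {L : Type*} [Field L] [Fintype L] [Algebra F L]
    (hc : Fintype.card L = Fintype.card F ^ 2) (T N : L → F)
    (hT : ∀ x, algebraMap F L (T x) = x + x ^ Fintype.card F)
    (hN : ∀ x, algebraMap F L (N x) = x * x ^ Fintype.card F) (uv : F × F) :
    #{xy : F × F | (xy.1 + xy.2, xy.1 * xy.2) = uv} + #{x : L | (T x, N x) = uv} = 2 := by
  have h1 : ∑ uv : F × F, (#{xy : F × F | (xy.1 + xy.2, xy.1 * xy.2) = uv} +
      #{x : L | (T x, N x) = uv}) = ∑ uv : F × F, 2 := by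
    rw [sum_add_distrib, ← card_eq_sum_card_fiberwise (fun _ _ ↦ mem_univ _),
      ← card_eq_sum_card_fiberwise (fun _ _ ↦ mem_univ _)]
    simp only [card_univ, Fintype.card_prod, hc, sum_const, smul_eq_mul]
    ring
  exact (sum_eq_sum_iff_of_le (fun uv _ ↦ card_pairs_add_card_conj_le T N hT hN uv)).mp h1 uv
    (mem_univ _)

lemma kloostermanSum_eq_sum_ite (Ψ : AddChar F ℂ) (a b : F) :
    kloostermanSum Ψ a b = ∑ x : F, if x = 0 then 0 else Ψ (a * x + b * x⁻¹) := by
  classical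
  unfold kloostermanSum
  have : (univ.filter fun x : F ↦ (if x = 0 then 0 else Ψ (a * x + b * x⁻¹)) ≠ 0) =
      univ.map ⟨Units.val, Units.val_injective⟩ := by
    ext x
    simp only [mem_filter, mem_univ, true_and, mem_map, Function.Embedding.coeFn_mk]
    constructor
    · intro h
      have : x ≠ 0 := by rintro rfl; simp at h
      exact ⟨Units.mk0 x this, rfl⟩
    · rintro ⟨u, rfl⟩
      simpa using (AddChar.val_isUnit Ψ _).ne_zero
  conv_rhs => rw [← sum_filter_ne_zero, this, sum_map]
  simp

lemma sum_comp_eq_sum_card {ι X : Type*} [Fintype ι] [Fintype X] [DecidableEq X] (W : X → ℂ)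
    (g : ι → X) :
    ∑ i, W (g i) = ∑ uv, (#{i | g i = uv} : ℂ) * W uv := by
  rw [← sum_fiberwise univ g]
  refine sum_congr rfl fun uv _ ↦ ?_
  rw [sum_congr rfl (g := fun _ ↦ W uv)]
  · simp
  · intro i hi
    rw [(mem_filter.mp hi).2]

/-- The Kloosterman sum over a quadratic extension, in terms of the sum over the base field. -/
lemma kloostermanSum_quadratic {L : Type*} [Field L] [Fintype L] [DecidableEq L] [Algebra F L]
    (hc : Fintype.card L = Fintype.card F ^ 2) {Ψ : AddChar F ℂ} (hΨ : Ψ ≠ 1) {a b : F}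
    (ha : a ≠ 0) (hb : b ≠ 0) :
    kloostermanSum (Ψ.compAddMonoidHom (Algebra.trace F L).toAddMonoidHom)
      (algebraMap F L a) (algebraMap F L b) =
      2 * Fintype.card F - kloostermanSum Ψ a b ^ 2 := by
  classical
  have hfr : Module.finrank F L = 2 := by
    have := Module.card_eq_pow_finrank (K := F) (V := L)
    rw [hc] at this
    exact (Nat.pow_right_injective Fintype.one_lt_card this).symm
  have hT : ∀ x : L, algebraMap F L (Algebra.trace F L x) = x + x ^ Fintype.card F := fun x ↦ by
    rw [FiniteField.algebraMap_trace_eq_sum_pow, hfr, sum_range_succ, sum_range_one]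
    simp
  have hN : ∀ x : L, algebraMap F L (Algebra.norm F x) = x * x ^ Fintype.card F := fun x ↦ by
    rw [FiniteField.algebraMap_norm_eq_prod_pow, hfr, prod_range_succ, prod_range_one]
    simp
  have hr := card_pairs_add_card_conj hc _ _ hT hN
  set W : F × F → ℂ := fun uv ↦ if uv.2 = 0 then 0 else Ψ (uv.1 * (a + b * uv.2⁻¹)) with hW
  have s1 : kloostermanSum Ψ a b ^ 2 = ∑ xy : F × F, W (xy.1 + xy.2, xy.1 * xy.2) := by
    rw [kloostermanSum_eq_sum_ite, sq, Fintype.sum_mul_sum, Fintype.sum_prod_type]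
    refine sum_congr rfl fun x _ ↦ sum_congr rfl fun y _ ↦ ?_
    simp only [hW, mul_eq_zero]
    by_cases hx : x = 0
    · simp [hx]
    by_cases hy : y = 0
    · simp [hy]
    simp only [hx, hy, if_false, or_self]
    rw [← AddChar.map_add_eq_mul]
    congr 1
    field_simp
    ring
  have s2 : kloostermanSum (Ψ.compAddMonoidHom (Algebra.trace F L).toAddMonoidHom)
      (algebraMap F L a) (algebraMap F L b) =
      ∑ x : L, W (Algebra.trace F L x, Algebra.norm F x) := by
    rw [kloostermanSum_eq_sum_ite]
    refine sum_congr rfl fun x _ ↦ ?_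
    simp only [hW, Algebra.norm_eq_zero_iff]
    by_cases hx : x = 0
    · simp [hx]
    simp only [hx, if_false, AddChar.compAddMonoidHom_apply]
    congr 1
    have hn : Algebra.norm F x ≠ 0 := by simpa using hx
    apply (algebraMap F L).injective
    change algebraMap F L (Algebra.trace F L _) = _
    rw [← Algebra.smul_def, ← Algebra.smul_def, map_add, map_smul, map_smul]
    have hn' := (map_ne_zero (algebraMap F L)).mpr hn
    simp only [map_add, smul_eq_mul, map_mul, map_inv₀]
    rw [hT, hT, hN, inv_pow]
    field_simp
    ring
  have hsum : ∑ uv, W uv = Fintype.card F := by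
    rw [Fintype.sum_prod_type_right]
    have : ∀ v : F, ∑ u : F, W (u, v) = if v = -b / a then (Fintype.card F : ℂ) else 0 := by
      intro v
      simp only [hW]
      by_cases hv : v = 0
      · rw [hv]
        rw [if_neg (by rw [eq_comm]; simp [ha, hb])]
        simp
      · simp only [hv, if_false]
        rw [AddChar.sum_mulShift _ (AddChar.IsPrimitive.of_ne_one hΨ)]
        have : a + b * v⁻¹ = 0 ↔ v = -b / a := by
          field_simp
          constructor <;> intro h <;> linear_combination h
        simp [this]
    simp [this]
  have hsplit : (∑ xy : F × F, W (xy.1 + xy.2, xy.1 * xy.2)) +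
      ∑ x : L, W (Algebra.trace F L x, Algebra.norm F x) = 2 * Fintype.card F := by
    rw [sum_comp_eq_sum_card W (fun xy : F × F ↦ (xy.1 + xy.2, xy.1 * xy.2)),
      sum_comp_eq_sum_card W (fun x : L ↦ (Algebra.trace F L x, Algebra.norm F x)),
      ← sum_add_distrib, ← hsum, mul_sum]
    refine sum_congr rfl fun uv _ ↦ ?_
    rw [← add_mul]
    congr 1
    exact_mod_cast hr uv
  rw [s2, s1]
  linear_combination hsplit

end QuadraticExtension

section ArtinSchreier

open Polynomial Finset

lemma Polynomial.exists_sum_C_mul_eq_zero {F : Type*} [Field F] {n D : ℕ} (v : Fin n → F[X])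
    (hv : ∀ e, (v e).natDegree < D) (hD : D < n) :
    ∃ β : Fin n → F, (∃ e, β e ≠ 0) ∧ ∑ e, C (β e) * v e = 0 := by
  have hmem : ∀ e, v e ∈ degreeLT F D := fun e ↦ by
    rw [mem_degreeLT]
    exact (degree_le_natDegree).trans_lt (by exact_mod_cast hv e)
  let w : Fin n → degreeLT F D := fun e ↦ ⟨v e, hmem e⟩
  have hfin : Module.finrank F (degreeLT F D) = D := by
    rw [(degreeLTEquiv F D).finrank_eq, Module.finrank_fin_fun]
  have : Module.Finite F (degreeLT F D) := Module.Finite.equiv (degreeLTEquiv F D).symm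
  have : ¬ LinearIndependent F w := fun h ↦ by
    have := h.fintype_card_le_finrank
    rw [hfin, Fintype.card_fin] at this
    omega
  obtain ⟨g, hg, i, hi⟩ := Fintype.not_linearIndependent_iff.mp this
  refine ⟨g, ⟨i, hi⟩, ?_⟩
  have := congrArg Subtype.val hg
  simpa [w, smul_eq_C_mul] using this

lemma Polynomial.sum_C_mul_X_pow_mul_ne_zero {F : Type*} [Field F] {n : ℕ} (α : Fin n → F)
    (G : Fin n → F[X]) (hG : ∀ e, (G e).coeff 0 ≠ 0) (hα : ∃ e, α e ≠ 0) :
    ∑ e, C (α e) * (X ^ (e : ℕ) * G e) ≠ 0 := by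
  classical
  obtain ⟨e, he, hmin⟩ := WellFounded.has_min (wellFounded_lt (α := Fin n)) {e | α e ≠ 0} hα
  intro h0
  have := congrArg (fun P ↦ P.coeff e) h0
  simp only [finsetSum_coeff, coeff_C_mul, coeff_zero] at this
  rw [sum_eq_single e] at this
  · rw [coeff_X_pow_mul', if_pos le_rfl, Nat.sub_self] at this
    exact mul_ne_zero he (hG e) this
  · intro e' _ hne
    rcases lt_or_gt_of_ne hne with h | h
    · have : α e' = 0 := by
        by_contra h'
        exact hmin e' h' h
      rw [this, zero_mul]
    · rw [coeff_X_pow_mul', if_neg (by simpa using h), mul_zero]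
  · simp

variable {F : Type*} [Field F] [Fintype F] {p : ℕ} [Fact p.Prime] [Algebra (ZMod p) F]

/-- Stepanov's bound for the fibres of `x ↦ Tr (a x + b / x)` over a field with `p ^ (2 m)`
elements. -/
lemma card_trace_fiber_le [DecidableEq F] {m : ℕ} (hm : 1 ≤ m)
    (hF : Fintype.card F = p ^ (2 * m)) (a b c : ZMod p) (hb : b ≠ 0) :
    #{x : F | x ≠ 0 ∧ Algebra.trace (ZMod p) F
        (algebraMap (ZMod p) F a * x + algebraMap (ZMod p) F b * x⁻¹) = c} ≤
      (p ^ (m - 1) + 6) * p ^ m := by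
  classical
  have hp : p.Prime := Fact.out
  have : CharP F p := charP_of_injective_algebraMap (algebraMap (ZMod p) F).injective p
  set r := p ^ (m - 1) with hr
  set Q := p ^ m with hQ
  have hrpos : 0 < r := pow_pos hp.pos _
  have hQr : Q = r * p := by rw [hr, hQ, ← pow_succ, Nat.sub_add_cancel hm]
  have hQpos : 0 < Q := pow_pos hp.pos _
  have h2Q : 2 * r ≤ Q := by rw [hQr, mul_comm]; exact Nat.mul_le_mul_left _ hp.two_le
  have hqQ : Fintype.card F = Q * Q := by rw [hF, hQ]; ring
  set A := algebraMap (ZMod p) F a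
  set B := algebraMap (ZMod p) F b with hB
  set c' := algebraMap (ZMod p) F c
  have hB0 : B ≠ 0 := by simpa [hB] using hb
  have hAp : ∀ (z : ZMod p) (i : ℕ), (algebraMap (ZMod p) F z) ^ p ^ i = algebraMap (ZMod p) F z :=
    fun z i ↦ by rw [← map_pow, ZMod.pow_card_pow]
  set H : F[X] := ∑ i ∈ range m, (C A * X ^ (r + p ^ i) + C B * X ^ (r - p ^ i)) with hH
  have hpi : ∀ i ∈ range m, p ^ i ≤ r := fun i hi ↦
    Nat.pow_le_pow_right hp.pos (by have := mem_range.mp hi; omega)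
  have hHdeg : H.natDegree ≤ 2 * r := by
    refine natDegree_sum_le_of_forall_le _ _ fun i hi ↦ ?_
    have := hpi i hi
    refine (natDegree_add_le _ _).trans (max_le ?_ ?_)
    · exact (natDegree_C_mul_X_pow_le _ _).trans (by omega)
    · exact (natDegree_C_mul_X_pow_le _ _).trans (by omega)
  have hH0 : H.coeff 0 ≠ 0 := by
    rw [hH, finsetSum_coeff, sum_eq_single (m - 1)]
    · rw [coeff_add, coeff_C_mul_X_pow, coeff_C_mul_X_pow, ← hr, Nat.sub_self, if_neg (by omega),
        if_pos rfl, zero_add]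
      exact hB0
    · intro i hi hne
      have hlt : p ^ i < r := Nat.pow_lt_pow_right hp.one_lt
        (by have := mem_range.mp hi; omega)
      rw [coeff_add, coeff_C_mul_X_pow, coeff_C_mul_X_pow, if_neg (by omega), if_neg (by omega),
        zero_add]
    · intro h
      exact absurd (mem_range.mpr (by omega)) h
  set K := r + 4 with hK
  set n := K * Q with hn
  let t : ℕ → ℕ := fun e ↦ e / r % p
  have ht : ∀ e, t e ≤ p - 1 := fun e ↦ Nat.le_sub_one_of_lt (Nat.mod_lt _ hp.pos)
  have hdecomp : ∀ e, e = Q * (e / Q) + r * t e + e % r := fun e ↦ by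
    have h1 := Nat.div_add_mod e r
    have h2 := Nat.div_add_mod (e / r) p
    rw [Nat.div_div_eq_div_mul, ← hQr] at h2
    calc e = r * (e / r) + e % r := h1.symm
      _ = r * (p * (e / Q) + t e) + e % r := by rw [h2]
      _ = _ := by rw [hQr]; ring
  let v : Fin n → F[X] := fun e ↦
    X ^ (Q * (e % r)) * (C c' * X ^ r - H) ^ (p - 1 - t e) * X ^ (r * t e + e / Q)
  have hvdeg : ∀ e, (v e).natDegree < Q * r + Q + K := by
    intro e
    have d1 : (C c' * X ^ r - H).natDegree ≤ 2 * r :=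
      (natDegree_sub_le _ _).trans (max_le ((natDegree_C_mul_X_pow_le _ _).trans (by omega)) hHdeg)
    have d2 : ((C c' * X ^ r - H) ^ (p - 1 - t e)).natDegree ≤ (p - 1 - t e) * (2 * r) :=
      natDegree_pow_le_of_le _ d1
    have d3 : (v e).natDegree ≤ Q * (e % r) + (p - 1 - t e) * (2 * r) + (r * t e + e / Q) := by
      refine natDegree_mul_le_of_le (natDegree_mul_le_of_le ?_ d2) ?_ <;> simp
    have d4 : (e : ℕ) / Q < K := Nat.div_lt_of_lt_mul (by rw [mul_comm]; exact e.2)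
    have d5 : Q * (e % r) + Q ≤ Q * r := by
      rw [← Nat.mul_succ]; exact Nat.mul_le_mul_left _ (Nat.mod_lt _ hrpos)
    have d6 : (p - 1 - t e) * (2 * r) + r * t e ≤ 2 * Q := by
      obtain ⟨s, hs⟩ := Nat.exists_eq_add_of_le (ht e)
      have hs' : p = t e + s + 1 := by have := hp.pos; omega
      have : p - 1 - t e = s := by omega
      rw [this, hQr]
      nlinarith
    omega
  obtain ⟨β, ⟨e₀, he₀⟩, hβ⟩ := exists_sum_C_mul_eq_zero v hvdeg (by
    rw [hn, hK]; nlinarith)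
  set S : F[X] := ∑ e : Fin n, C (β e ^ Q) * (X ^ (e : ℕ) * H ^ (p - 1 - t e)) with hS
  have hS0 : S ≠ 0 := by
    refine sum_C_mul_X_pow_mul_ne_zero (fun e ↦ β e ^ Q) _ (fun e ↦ ?_) ⟨e₀, pow_ne_zero _ he₀⟩
    rw [coeff_zero_eq_eval_zero, eval_pow, ← coeff_zero_eq_eval_zero]
    exact pow_ne_zero _ hH0
  have hSdeg : S.natDegree ≤ (r + 6) * Q := by
    refine natDegree_sum_le_of_forall_le _ _ fun e _ ↦ ?_
    refine (natDegree_C_mul_le _ _).trans ?_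
    have d2 : (H ^ (p - 1 - t e)).natDegree ≤ (p - 1 - t e) * (2 * r) :=
      natDegree_pow_le_of_le _ hHdeg
    refine (natDegree_mul_le_of_le (natDegree_X_pow_le _) d2).trans ?_
    have : (p - 1 - t e) * (2 * r) ≤ 2 * Q := by
      rw [hQr]
      have : p - 1 - t e ≤ p := by omega
      nlinarith
    have he : (e : ℕ) < n := e.2
    have hn' : n = r * Q + 4 * Q := by rw [hn, hK, add_mul]
    rw [add_mul]
    omega
  refine (card_le_degree_of_subset_roots (p := S) ?_).trans hSdeg
  intro x hx
  simp only [filter_val, Multiset.mem_filter, mem_val, mem_univ, true_and] at hx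
  obtain ⟨hx0, hxc⟩ := hx
  rw [mem_roots hS0, IsRoot.def]
  set G : F := ∑ i ∈ range m, (A * x + B * x⁻¹) ^ p ^ i with hG
  have hGQ : G ^ Q = c' - G := by
    have h1 := congrArg (algebraMap (ZMod p) F) hxc
    rw [FiniteField.algebraMap_trace_eq_sum_pow] at h1
    have hfr : Module.finrank (ZMod p) F = 2 * m := by
      have := Module.card_eq_pow_finrank (K := ZMod p) (V := F)
      rw [hF, ZMod.card] at this
      exact (Nat.pow_right_injective hp.two_le this).symm
    rw [hfr, Nat.card_zmod, two_mul, sum_range_add, ← hG] at h1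
    change _ = c' at h1
    rw [eq_sub_iff_add_eq', ← h1, hG, hQ, sum_pow_char_pow]
    congr 1
    refine sum_congr rfl fun i _ ↦ ?_
    rw [← pow_mul, ← pow_add, add_comm i m]
  have hHx : H.eval x = x ^ r * G := by
    rw [hH, eval_finsetSum, hG, mul_sum]
    refine sum_congr rfl fun i hi ↦ ?_
    have := hpi i hi
    rw [add_pow_char_pow, mul_pow, mul_pow, hAp, hAp]
    simp only [eval_add, eval_mul, eval_C, eval_pow, eval_X]
    rw [pow_add, pow_sub₀ _ hx0 this, inv_pow]
    ring
  have hxq : ∀ k, x ^ (Q * Q * k) = x ^ k := fun k ↦ by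
    rw [pow_mul, ← hqQ, FiniteField.pow_card]
  have hkey : x ^ (r * (p - 1)) * (S.eval x) ^ Q =
      x ^ (r * Q * (p - 1)) * (∑ e, C (β e) * v e).eval x := by
    rw [hS, eval_finsetSum, eval_finsetSum]
    have hQsum : (∑ e : Fin n, eval x (C (β e ^ Q) * (X ^ (e : ℕ) * H ^ (p - 1 - t e)))) ^ Q =
        ∑ e : Fin n, (eval x (C (β e ^ Q) * (X ^ (e : ℕ) * H ^ (p - 1 - t e)))) ^ Q := by
      rw [hQ, sum_pow_char_pow]
    rw [hQsum, mul_sum, mul_sum]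
    refine sum_congr rfl fun e _ ↦ ?_
    simp only [v, eval_mul, eval_C, eval_pow, eval_X, eval_sub, hHx]
    set j := p - 1 - t e with hj
    have hjt : p - 1 = j + t e := by have := ht e; omega
    have hβq : (β e ^ Q) ^ Q = β e := by rw [← pow_mul, ← hqQ, FiniteField.pow_card]
    have hxe : (x ^ (e : ℕ)) ^ Q = x ^ ((e : ℕ) / Q) * x ^ (Q * (r * t e)) * x ^ (Q * (e % r)) := by
      conv_lhs => rw [hdecomp e]
      rw [← pow_mul, ← hxq (e / Q), ← pow_add, ← pow_add]
      congr 1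
      ring
    rw [show c' * x ^ r - x ^ r * G = x ^ r * (c' - G) by ring, ← hGQ]
    simp only [mul_pow, hβq, hxe, hjt]
    ring
  rw [hβ, eval_zero, mul_zero] at hkey
  exact pow_eq_zero_iff hQpos.ne' |>.mp ((mul_eq_zero.mp hkey).resolve_left (pow_ne_zero _ hx0))

end ArtinSchreier

section PrimeModulus

open Finset

lemma exists_field_kloostermanSum_iterate (p : ℕ) [Fact p.Prime] (j : ℕ) :
    ∃ (F : Type) (_ : Field F) (_ : Fintype F) (_ : DecidableEq F) (_ : Algebra (ZMod p) F),
      Fintype.card F = p ^ 2 ^ j ∧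
      ∀ Ψ : AddChar (ZMod p) ℂ, Ψ ≠ 1 → ∀ a b : ZMod p, a ≠ 0 → b ≠ 0 → ∀ s : ℂ,
        kloostermanSum Ψ a b = -(√p : ℝ) * s →
        kloostermanSum (Ψ.compAddMonoidHom (Algebra.trace (ZMod p) F).toAddMonoidHom)
          (algebraMap _ F a) (algebraMap _ F b) =
          -((√p : ℝ) : ℂ) ^ 2 ^ j * (fun z : ℂ ↦ z ^ 2 - 2)^[j] s := by
  classical
  induction j with
  | zero =>
    refine ⟨ZMod p, inferInstance, inferInstance, inferInstance, inferInstance, ?_, ?_⟩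
    · simp [ZMod.card]
    · intro Ψ _ a b _ _ s hs
      have : Ψ.compAddMonoidHom (Algebra.trace (ZMod p) (ZMod p)).toAddMonoidHom = Ψ := by
        ext x
        simp
      rw [this]
      simpa using hs
  | succ j ih =>
    obtain ⟨F, _, _, _, _, hcard, hF⟩ := ih
    have : CharP F p := charP_of_injective_algebraMap (algebraMap (ZMod p) F).injective p
    let L := FiniteField.Extension F p 2
    have : Fintype L := Fintype.ofFinite L
    have : DecidableEq L := Classical.decEq L
    have hL : Fintype.card L = Fintype.card F ^ 2 := by
      rw [← Nat.card_eq_fintype_card, FiniteField.natCard_extension, Nat.card_eq_fintype_card]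
    refine ⟨L, inferInstance, inferInstance, inferInstance, inferInstance, ?_, ?_⟩
    · rw [hL, hcard, ← pow_mul, pow_succ]
    · intro Ψ hΨ a b ha hb s hs
      have h0 := hF Ψ hΨ a b ha hb s hs
      have hne : Ψ.compAddMonoidHom (Algebra.trace (ZMod p) F).toAddMonoidHom ≠ 1 := by
        obtain ⟨y, hy⟩ := AddChar.ne_one_iff.mp hΨ
        obtain ⟨x, rfl⟩ := Algebra.trace_surjective (ZMod p) F y
        exact AddChar.ne_one_iff.mpr ⟨x, hy⟩
      have h1 := kloostermanSum_quadratic (L := L) hL hne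
        ((map_ne_zero (algebraMap (ZMod p) F)).mpr ha)
        ((map_ne_zero (algebraMap (ZMod p) F)).mpr hb)
      have h2 : (Ψ.compAddMonoidHom (Algebra.trace (ZMod p) F).toAddMonoidHom).compAddMonoidHom
          (Algebra.trace F L).toAddMonoidHom =
          Ψ.compAddMonoidHom (Algebra.trace (ZMod p) L).toAddMonoidHom := by
        ext x
        exact congrArg Ψ (Algebra.trace_trace (R := ZMod p) (S := F) x)
      rw [h2, ← IsScalarTower.algebraMap_apply, ← IsScalarTower.algebraMap_apply, h0, hcard] at h1
      have hsq : ((√p : ℝ) : ℂ) ^ 2 = p := by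
        rw [← Complex.ofReal_pow, Real.sq_sqrt (Nat.cast_nonneg p)]
        simp
      rw [h1, Function.iterate_succ_apply', pow_succ 2 j, pow_mul]
      have : ((p ^ 2 ^ j : ℕ) : ℂ) = (((√p : ℝ) : ℂ) ^ 2 ^ j) ^ 2 := by
        rw [← pow_mul, mul_comm, pow_mul, hsq]
        simp
      rw [this]
      ring

lemma kloostermanSum_conj {p : ℕ} [Fact p.Prime] (Ψ : AddChar (ZMod p) ℂ) (a b : ZMod p) :
    (starRingEnd ℂ) (kloostermanSum Ψ a b) = kloostermanSum Ψ a b := by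
  have hpos : 0 < ringChar (ZMod p) := by
    rw [ZMod.ringChar_zmod_n]; exact (Fact.out : p.Prime).pos
  unfold kloostermanSum
  rw [map_sum]
  refine Fintype.sum_equiv (Equiv.neg _) _ _ fun u ↦ ?_
  rw [AddChar.starComp_apply hpos, AddChar.inv_apply]
  rw [Equiv.neg_apply, inv_neg, Units.val_neg, Units.val_neg]
  ring_nf

lemma two_add_le_iterate_sq_sub_two {s : ℝ} (hs : 2 < |s|) (j : ℕ) :
    2 + 4 ^ j * (s ^ 2 - 4) ≤ (fun z : ℝ ↦ z ^ 2 - 2)^[j + 1] s := by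
  have h4 : 0 < s ^ 2 - 4 := by
    rw [← sq_abs]; nlinarith
  induction j with
  | zero => simp; linarith
  | succ j ih =>
    rw [Function.iterate_succ_apply']
    have : 0 < 4 ^ j * (s ^ 2 - 4) := by positivity
    rw [pow_succ]
    nlinarith

lemma sum_kloostermanSum_trace_ge {F : Type*} [Field F] [Fintype F] [DecidableEq F] {p : ℕ}
    [Fact p.Prime] [Algebra (ZMod p) F] {m : ℕ} (hm : 1 ≤ m)
    (hF : Fintype.card F = p ^ (2 * m)) {Ψ : AddChar (ZMod p) ℂ} (hΨ : Ψ ≠ 1) {a b : ZMod p}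
    (hb : b ≠ 0) :
    -(7 * p ^ 2 * p ^ m : ℝ) ≤ (∑ t ∈ univ.erase (0 : ZMod p), kloostermanSum
      ((Ψ.mulShift t).compAddMonoidHom (Algebra.trace (ZMod p) F).toAddMonoidHom)
      (algebraMap _ F a) (algebraMap _ F b)).re := by
  have hp : p.Prime := Fact.out
  set g : Fˣ → ZMod p := fun u ↦ Algebra.trace (ZMod p) F
    (algebraMap _ F a * u + algebraMap _ F b * (↑u⁻¹ : F)) with hg
  have hsum : ∑ t, kloostermanSum
      ((Ψ.mulShift t).compAddMonoidHom (Algebra.trace (ZMod p) F).toAddMonoidHom)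
      (algebraMap _ F a) (algebraMap _ F b) = (p * #{u | g u = 0} : ℕ) := by
    simp only [kloostermanSum]
    rw [sum_comm]
    have : ∀ u : Fˣ, ∑ t : ZMod p, ((Ψ.mulShift t).compAddMonoidHom
        (Algebra.trace (ZMod p) F).toAddMonoidHom)
        (algebraMap _ F a * u + algebraMap _ F b * (↑u⁻¹ : F)) =
        if g u = 0 then (p : ℂ) else 0 := by
      intro u
      have := AddChar.sum_mulShift (g u) (AddChar.IsPrimitive.of_ne_one hΨ)
      rw [ZMod.card] at this
      push_cast at this
      rw [← this]
      rfl
    rw [sum_congr rfl fun u _ ↦ this u, ← sum_filter, sum_const]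
    push_cast
    rw [nsmul_eq_mul, mul_comm]
  have h0 : kloostermanSum
      ((Ψ.mulShift 0).compAddMonoidHom (Algebra.trace (ZMod p) F).toAddMonoidHom)
      (algebraMap _ F a) (algebraMap _ F b) = (p ^ (2 * m) : ℂ) - 1 := by
    simp only [kloostermanSum, AddChar.mulShift_zero]
    have : ∀ x : F, ((1 : AddChar (ZMod p) ℂ).compAddMonoidHom
      (Algebra.trace (ZMod p) F).toAddMonoidHom) x = 1 := fun x ↦ rfl
    rw [sum_congr rfl fun u _ ↦ this _, sum_const, card_univ, Fintype.card_units, hF]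
    have : 1 ≤ p ^ (2 * m) := Nat.one_le_pow _ _ hp.pos
    simp [Nat.cast_sub this]
  have hfib : ∀ c : ZMod p, #{u | g u = c} ≤ (p ^ (m - 1) + 6) * p ^ m := fun c ↦ by
    refine le_trans ?_ (card_trace_fiber_le hm hF a b c hb)
    refine card_le_card_of_injOn Units.val (fun u hu ↦ ?_) Units.val_injective.injOn
    simp only [coe_filter, mem_univ, true_and, Set.mem_ofPred_eq] at hu ⊢
    refine ⟨u.ne_zero, ?_⟩
    rw [← hu, hg]
    simp
  have htot : #{u | g u = 0} + ∑ c ∈ univ.erase (0 : ZMod p), #{u | g u = c} =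
      p ^ (2 * m) - 1 := by
    rw [add_sum_erase univ (fun c ↦ #{u | g u = c}) (mem_univ 0),
      ← card_eq_sum_card_fiberwise (fun _ _ ↦ mem_univ _), card_univ, Fintype.card_units, hF]
  have hrest : ∑ c ∈ univ.erase (0 : ZMod p), #{u | g u = c} ≤
      (p - 1) * ((p ^ (m - 1) + 6) * p ^ m) := by
    refine (sum_le_card_nsmul _ _ _ fun c _ ↦ hfib c).trans_eq ?_
    rw [card_erase_of_mem (mem_univ _), card_univ, ZMod.card, smul_eq_mul]
  rw [← add_sum_erase univ _ (mem_univ (0 : ZMod p)), h0] at hsum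
  have hre := congrArg Complex.re hsum
  have hcast : ((p : ℂ) ^ (2 * m) - 1).re = (p : ℝ) ^ (2 * m) - 1 := by
    rw [← Nat.cast_pow, Complex.sub_re, Complex.natCast_re, Complex.one_re, Nat.cast_pow]
  rw [Complex.add_re, hcast, Complex.natCast_re] at hre
  have e1 : (#{u | g u = 0} : ℝ) + (∑ c ∈ univ.erase (0 : ZMod p), #{u | g u = c} : ℕ) =
      (p : ℝ) ^ (2 * m) - 1 := by
    have : 1 ≤ p ^ (2 * m) := Nat.one_le_pow _ _ hp.pos
    have h := congrArg (Nat.cast : ℕ → ℝ) htot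
    rw [Nat.cast_add, Nat.cast_sub this] at h
    rw [h]; simp
  have e2 : ((∑ c ∈ univ.erase (0 : ZMod p), #{u | g u = c} : ℕ) : ℝ) ≤
      ((p : ℝ) - 1) * (((p : ℝ) ^ (m - 1) + 6) * (p : ℝ) ^ m) := by
    have h : ((∑ c ∈ univ.erase (0 : ZMod p), #{u | g u = c} : ℕ) : ℝ) ≤ _ :=
      Nat.cast_le.mpr hrest
    rw [Nat.cast_mul, Nat.cast_sub hp.one_le] at h
    push_cast at h ⊢
    exact h
  have hpm : (p : ℝ) ^ m = p * (p : ℝ) ^ (m - 1) := by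
    rw [← pow_succ', Nat.sub_add_cancel hm]
  have hp2m : (p : ℝ) ^ (2 * m) = (p : ℝ) ^ m * (p : ℝ) ^ m := by rw [← pow_add, two_mul]
  push_cast at hre e1 e2
  set N0 := (#{u | g u = 0} : ℝ)
  set Q := (p : ℝ) ^ m
  set r := (p : ℝ) ^ (m - 1)
  have hp1 : (1 : ℝ) ≤ p := by exact_mod_cast hp.one_le
  have hQ1 : (1 : ℝ) ≤ Q := one_le_pow₀ hp1
  have e3 : Q * Q - 1 - ((p : ℝ) - 1) * ((r + 6) * Q) ≤ N0 := by linarith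
  have e4 : (p : ℝ) * (Q * Q - 1 - ((p : ℝ) - 1) * ((r + 6) * Q)) ≤ p * N0 := by gcongr
  have e5 : (p : ℝ) * (Q * Q - 1 - ((p : ℝ) - 1) * ((r + 6) * Q)) - (Q * Q - 1) =
      -(((p : ℝ) - 1) * (1 + 6 * p * Q)) := by rw [hpm]; ring
  have e6 : ((p : ℝ) - 1) * (1 + 6 * p * Q) ≤ 7 * p ^ 2 * Q := by
    have : (1 : ℝ) ≤ p * Q := one_le_mul_of_one_le_of_one_le hp1 hQ1
    nlinarith
  linarith

/-- **Weil's bound** for Kloosterman sums to a prime modulus. -/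
lemma norm_kloostermanSum_prime_le {p : ℕ} [Fact p.Prime] {Ψ : AddChar (ZMod p) ℂ} (hΨ : Ψ ≠ 1)
    {a b : ZMod p} (ha : a ≠ 0) (hb : b ≠ 0) : ‖kloostermanSum Ψ a b‖ ≤ 2 * √p := by
  have hp : p.Prime := Fact.out
  have hprim := AddChar.IsPrimitive.of_ne_one hΨ
  have hsp : 0 < √(p : ℝ) := Real.sqrt_pos.mpr (by exact_mod_cast hp.pos)
  set s : ZMod p → ℝ := fun t ↦ -(kloostermanSum (Ψ.mulShift t) a b).re / √p with hs
  have hreal : ∀ t, kloostermanSum (Ψ.mulShift t) a b = -((√p : ℝ) : ℂ) * (s t : ℂ) := by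
    intro t
    have := Complex.conj_eq_iff_re.mp (kloostermanSum_conj (Ψ.mulShift t) a b)
    conv_lhs => rw [← this]
    rw [hs]
    push_cast
    have : ((√p : ℝ) : ℂ) ≠ 0 := by exact_mod_cast hsp.ne'
    field_simp
  have hsum : ∀ j, ∑ t ∈ univ.erase (0 : ZMod p), (fun z : ℝ ↦ z ^ 2 - 2)^[j + 1] (s t) ≤
      7 * p ^ 2 := by
    intro j
    obtain ⟨F, _, _, _, _, hcard, hF⟩ := exists_field_kloostermanSum_iterate p (j + 1)
    have hcard' : Fintype.card F = p ^ (2 * 2 ^ j) := by rw [hcard, pow_succ' 2 j]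
    have h1 := sum_kloostermanSum_trace_ge (Nat.one_le_two_pow (n := j)) hcard' hΨ (a := a) hb
    have h2 : ∀ t ∈ univ.erase (0 : ZMod p), kloostermanSum
        ((Ψ.mulShift t).compAddMonoidHom (Algebra.trace (ZMod p) F).toAddMonoidHom)
        (algebraMap _ F a) (algebraMap _ F b) =
        ((-(√(p : ℝ)) ^ 2 ^ (j + 1) * (fun z : ℝ ↦ z ^ 2 - 2)^[j + 1] (s t) : ℝ) : ℂ) := by
      intro t ht
      rw [hF _ (hprim (ne_of_mem_erase ht)) a b ha hb _ (hreal t)]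
      have hsemi : Function.Semiconj (Complex.ofReal) (fun z : ℝ ↦ z ^ 2 - 2)
          (fun z : ℂ ↦ z ^ 2 - 2) := fun z ↦ by simp
      rw [← (hsemi.iterate_right (j + 1)) (s t)]
      push_cast
      rfl
    have hpow : √(p : ℝ) ^ 2 ^ (j + 1) = (p : ℝ) ^ 2 ^ j := by
      rw [pow_succ', pow_mul, Real.sq_sqrt (Nat.cast_nonneg p)]
    rw [sum_congr rfl h2, ← Complex.ofReal_sum, Complex.ofReal_re, ← mul_sum, hpow] at h1
    have hpos : 0 < (p : ℝ) ^ 2 ^ j := pow_pos (by exact_mod_cast hp.pos) _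
    have h3 : (p : ℝ) ^ 2 ^ j * ∑ t ∈ univ.erase (0 : ZMod p),
        (fun z : ℝ ↦ z ^ 2 - 2)^[j + 1] (s t) ≤ (p : ℝ) ^ 2 ^ j * (7 * p ^ 2) := by linarith
    exact le_of_mul_le_mul_left h3 hpos
  have hs1 : |s 1| ≤ 2 := by
    by_contra! h
    have h4 : 0 < s 1 ^ 2 - 4 := by
      rw [← sq_abs]; nlinarith
    have hlow : ∀ j, 4 ^ j * (s 1 ^ 2 - 4) - 2 * p ≤ 7 * (p : ℝ) ^ 2 := by
      intro j
      refine le_trans ?_ (hsum j)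
      have h1mem : (1 : ZMod p) ∈ univ.erase (0 : ZMod p) := by simp
      rw [← add_sum_erase _ _ h1mem]
      have h5 := two_add_le_iterate_sq_sub_two h j
      have h6 : -(2 * p : ℝ) ≤ ∑ t ∈ (univ.erase (0 : ZMod p)).erase 1,
          (fun z : ℝ ↦ z ^ 2 - 2)^[j + 1] (s t) := by
        have : ∀ t ∈ (univ.erase (0 : ZMod p)).erase 1,
            (-2 : ℝ) ≤ (fun z : ℝ ↦ z ^ 2 - 2)^[j + 1] (s t) := fun t _ ↦ by
          rw [Function.iterate_succ_apply']
          nlinarith [sq_nonneg ((fun z : ℝ ↦ z ^ 2 - 2)^[j] (s t))]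
        refine le_trans ?_ (card_nsmul_le_sum _ _ _ this)
        have hc : #((univ.erase (0 : ZMod p)).erase 1) ≤ p := by
          refine (card_le_univ _).trans_eq (ZMod.card p)
        have hc' : (#((univ.erase (0 : ZMod p)).erase 1) : ℝ) ≤ p := by exact_mod_cast hc
        rw [nsmul_eq_mul]
        linarith
      linarith
    obtain ⟨j, hj⟩ := pow_unbounded_of_one_lt ((7 * (p : ℝ) ^ 2 + 2 * p) / (s 1 ^ 2 - 4))
      (by norm_num : (1 : ℝ) < 4)
    rw [div_lt_iff₀ h4] at hj
    linarith [hlow j]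
  have h1 := hreal 1
  rw [AddChar.mulShift_one] at h1
  rw [h1, norm_mul, norm_neg, Complex.norm_real, Complex.norm_real, Real.norm_eq_abs,
    Real.norm_eq_abs, abs_of_pos hsp]
  nlinarith

end PrimeModulus

section CompositeModulus

open Finset

lemma kloostermanSum_comm {R : Type*} [CommRing R] [Fintype Rˣ] (Ψ : AddChar R ℂ) (a b : R) :
    kloostermanSum Ψ a b = kloostermanSum Ψ b a := by
  refine Fintype.sum_equiv (Equiv.inv _) _ _ fun u ↦ ?_
  rw [Equiv.inv_apply, inv_inv, add_comm]

lemma norm_kloostermanSum_le_card {R : Type*} [CommRing R] [Finite R] [Fintype Rˣ]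
    (Ψ : AddChar R ℂ) (a b : R) : ‖kloostermanSum Ψ a b‖ ≤ Fintype.card Rˣ := by
  refine (norm_sum_le _ _).trans ?_
  simp [AddChar.norm_apply]

lemma kloostermanSum_ringEquiv {R S : Type*} [CommRing R] [CommRing S] [Fintype Rˣ] [Fintype Sˣ]
    (e : R ≃+* S) (Ψ : AddChar S ℂ) (a b : R) :
    kloostermanSum (Ψ.compAddMonoidHom (e : R →+ S)) a b = kloostermanSum Ψ (e a) (e b) := by
  refine Fintype.sum_equiv (Units.mapEquiv e.toMulEquiv).toEquiv _ _ fun u ↦ ?_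
  rw [AddChar.compAddMonoidHom_apply]
  congr 1
  have h1 : ((Units.mapEquiv e.toMulEquiv u : Sˣ) : S) = e u := rfl
  have h2 : (((Units.mapEquiv e.toMulEquiv u)⁻¹ : Sˣ) : S) = e (↑u⁻¹ : R) := by
    rw [← map_inv]; rfl
  change e _ = e a * ((Units.mapEquiv e.toMulEquiv u : Sˣ) : S) +
    e b * (((Units.mapEquiv e.toMulEquiv u)⁻¹ : Sˣ) : S)
  rw [h1, h2, map_add, map_mul, map_mul]

lemma kloostermanSum_prod {R S : Type*} [CommRing R] [CommRing S] [Fintype Rˣ] [Fintype Sˣ]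
    [Fintype (R × S)ˣ] (Ψ : AddChar (R × S) ℂ) (a b : R × S) :
    kloostermanSum Ψ a b =
      kloostermanSum (Ψ.compAddMonoidHom (AddMonoidHom.inl R S)) a.1 b.1 *
      kloostermanSum (Ψ.compAddMonoidHom (AddMonoidHom.inr R S)) a.2 b.2 := by
  unfold kloostermanSum
  rw [Fintype.sum_mul_sum, ← Fintype.sum_prod_type']
  refine Fintype.sum_equiv MulEquiv.prodUnits.toEquiv _ _ fun u ↦ ?_
  rw [AddChar.compAddMonoidHom_apply, AddChar.compAddMonoidHom_apply, ← AddChar.map_add_eq_mul]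
  congr 1
  ext <;> simp [MulEquiv.prodUnits]

lemma isPrimitive_comp_ringEquiv {R S : Type*} [CommRing R] [CommRing S] (e : R ≃+* S)
    {Ψ : AddChar S ℂ} (h : Ψ.IsPrimitive) :
    (Ψ.compAddMonoidHom (e : R →+ S)).IsPrimitive := by
  intro a ha h1
  refine h ((map_ne_zero_iff e e.injective).mpr ha) ?_
  ext x
  have := DFunLike.congr_fun h1 (e.symm x)
  simpa [AddChar.mulShift_apply] using this

lemma isPrimitive_comp_inl {R S : Type*} [CommRing R] [CommRing S] {Ψ : AddChar (R × S) ℂ}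
    (h : Ψ.IsPrimitive) : (Ψ.compAddMonoidHom (AddMonoidHom.inl R S)).IsPrimitive := by
  intro a ha h1
  refine h (a := (a, 0)) (by simpa using ha) ?_
  ext x
  have := DFunLike.congr_fun h1 x.1
  simpa [AddChar.mulShift_apply, Prod.mul_def] using this

lemma isPrimitive_comp_inr {R S : Type*} [CommRing R] [CommRing S] {Ψ : AddChar (R × S) ℂ}
    (h : Ψ.IsPrimitive) : (Ψ.compAddMonoidHom (AddMonoidHom.inr R S)).IsPrimitive := by
  intro a ha h1
  refine h (a := (0, a)) (by simpa using ha) ?_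
  ext x
  have := DFunLike.congr_fun h1 x.2
  simpa [AddChar.mulShift_apply, Prod.mul_def] using this

/-- Multiplicativity of Kloosterman sums in the modulus. -/
lemma exists_kloostermanSum_eq_mul {m n : ℕ} [NeZero m] [NeZero n] [NeZero (m * n)]
    (hmn : m.Coprime n) {Ψ : AddChar (ZMod (m * n)) ℂ} (hΨ : Ψ.IsPrimitive) (a b : ℤ) :
    ∃ (Ψ₁ : AddChar (ZMod m) ℂ) (Ψ₂ : AddChar (ZMod n) ℂ), Ψ₁.IsPrimitive ∧ Ψ₂.IsPrimitive ∧
      kloostermanSum Ψ (a : ZMod (m * n)) b =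
        kloostermanSum Ψ₁ (a : ZMod m) b * kloostermanSum Ψ₂ (a : ZMod n) b := by
  let e := ZMod.chineseRemainder hmn
  let Ψ' := Ψ.compAddMonoidHom (e.symm : ZMod m × ZMod n →+ ZMod (m * n))
  have h' : Ψ'.IsPrimitive := isPrimitive_comp_ringEquiv e.symm hΨ
  refine ⟨_, _, isPrimitive_comp_inl h', isPrimitive_comp_inr h', ?_⟩
  have := kloostermanSum_prod Ψ' (a : ZMod m × ZMod n) b
  rw [kloostermanSum_ringEquiv, map_intCast, map_intCast] at this
  simpa using this

/-- The additive map `ZMod n → ZMod (p * n)` induced by multiplication by `p`. -/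
def ZMod.mulLeftHom (p n : ℕ) : ZMod n →+ ZMod (p * n) :=
  ZMod.lift n ⟨(AddMonoidHom.mulLeft (p : ZMod (p * n))).comp (Int.castAddHom _), by
    have := ZMod.natCast_self (p * n)
    push_cast at this
    simpa using this⟩

lemma ZMod.mulLeftHom_intCast (p n : ℕ) (x : ℤ) :
    ZMod.mulLeftHom p n x = (p : ZMod (p * n)) * x := by
  simp [ZMod.mulLeftHom]

lemma isPrimitive_comp_mulLeftHom {p n : ℕ} (hp : p ≠ 0) {Ψ : AddChar (ZMod (p * n)) ℂ}
    (h : Ψ.IsPrimitive) : (Ψ.compAddMonoidHom (ZMod.mulLeftHom p n)).IsPrimitive := by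
  intro a ha h1
  obtain ⟨a, rfl⟩ := ZMod.intCast_surjective a
  have hne : ((p * a : ℤ) : ZMod (p * n)) ≠ 0 := by
    rw [Ne, ZMod.intCast_zmod_eq_zero_iff_dvd] at ha ⊢
    push_cast
    rwa [mul_dvd_mul_iff_left (by exact_mod_cast hp)]
  refine h hne ?_
  ext x
  obtain ⟨x, rfl⟩ := ZMod.intCast_surjective x
  have := DFunLike.congr_fun h1 (x : ZMod n)
  rw [AddChar.mulShift_apply, AddChar.compAddMonoidHom_apply, ← Int.cast_mul,
    ZMod.mulLeftHom_intCast] at this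
  rw [AddChar.mulShift_apply]
  push_cast at this ⊢
  rw [mul_assoc]
  exact this

lemma sum_comp_eq_mul_sum {G H : Type*} [Group G] [Group H] [Fintype G] [Fintype H]
    (φ : G →* H) (hφ : Function.Surjective φ) (f : H → ℂ) :
    ∑ g, f (φ g) = Nat.card φ.ker * ∑ h, f h := by
  classical
  have := sum_fiberwise_of_maps_to (s := univ) (t := univ) (g := φ) (fun _ _ ↦ mem_univ _)
    (fun g ↦ f (φ g))
  rw [← this, mul_sum]
  refine sum_congr rfl fun h _ ↦ ?_
  rw [sum_congr rfl (g := fun _ ↦ f h) (by simp +contextual), sum_const, nsmul_eq_mul]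
  congr 2
  have := MonoidHom.card_fiber_eq_of_mem_range φ (hφ h) (hφ 1)
  rw [this, Nat.card_eq_fintype_card, Fintype.card_subtype]
  simp only [MonoidHom.mem_ker]

lemma norm_kloostermanSum_mul_le {p n : ℕ} [NeZero n] [NeZero (p * n)] (hp : p.Prime)
    (Ψ : AddChar (ZMod (p * n)) ℂ) (a b : ℤ) :
    ‖kloostermanSum Ψ (((p * a : ℤ)) : ZMod (p * n)) ((p * b : ℤ) : ZMod (p * n))‖ ≤
      p * ‖kloostermanSum (Ψ.compAddMonoidHom (ZMod.mulLeftHom p n)) (a : ZMod n) b‖ := by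
  have hd : n ∣ p * n := Dvd.intro_left _ rfl
  have hkey : kloostermanSum Ψ (((p * a : ℤ)) : ZMod (p * n)) ((p * b : ℤ) : ZMod (p * n)) =
      Nat.card (ZMod.unitsMap hd).ker *
        kloostermanSum (Ψ.compAddMonoidHom (ZMod.mulLeftHom p n)) (a : ZMod n) b := by
    unfold kloostermanSum
    rw [← sum_comp_eq_mul_sum _ (ZMod.unitsMap_surjective hd)]
    refine sum_congr rfl fun u _ ↦ ?_
    rw [AddChar.compAddMonoidHom_apply]
    congr 1
    obtain ⟨x, hx⟩ := ZMod.intCast_surjective (u : ZMod (p * n))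
    obtain ⟨y, hy⟩ := ZMod.intCast_surjective (↑u⁻¹ : ZMod (p * n))
    have e1 : ((ZMod.unitsMap hd u : (ZMod n)ˣ) : ZMod n) = x := by
      rw [ZMod.unitsMap_val, ← hx]; simp [ZMod.cast_intCast hd]
    have e2 : (((ZMod.unitsMap hd u)⁻¹ : (ZMod n)ˣ) : ZMod n) = y := by
      rw [← map_inv, ZMod.unitsMap_val, ← hy]; simp [ZMod.cast_intCast hd]
    rw [e1, e2, ← hx, ← hy]
    rw [show (a : ZMod n) * x + b * y = ((a * x + b * y : ℤ) : ZMod n) by push_cast; rfl,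
      ZMod.mulLeftHom_intCast]
    push_cast
    ring
  rw [hkey, norm_mul, Complex.norm_natCast]
  gcongr
  have h1 : Nat.card (ZMod.unitsMap hd).ker * n.totient = (p * n).totient := by
    have := Subgroup.card_mul_index (ZMod.unitsMap hd).ker
    rw [Subgroup.index_ker, MonoidHom.range_eq_top.mpr (ZMod.unitsMap_surjective hd),
      Subgroup.card_top, Nat.card_eq_fintype_card, Nat.card_eq_fintype_card,
      Nat.card_eq_fintype_card, ZMod.card_units_eq_totient, ZMod.card_units_eq_totient] at this
    rw [Nat.card_eq_fintype_card]
    exact this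
  have h2 : (p * n).totient ≤ p * n.totient := by
    by_cases h : p ∣ n
    · exact (Nat.totient_mul_of_prime_of_dvd hp h).le
    · rw [Nat.totient_mul_of_prime_of_not_dvd hp h]
      gcongr
      omega
  have h3 : 0 < n.totient := Nat.totient_pos.mpr (NeZero.pos n)
  exact Nat.le_of_mul_le_mul_right (h1.trans_le h2) h3

end CompositeModulus

section StationaryPhase

open Finset

variable {R : Type*} [CommRing R] [Fintype R]

lemma norm_sum_quadratic_sq_le [DecidableEq R] {Ψ : AddChar R ℂ} (hΨ : Ψ.IsPrimitive) (α β γ : R) :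
    ‖∑ w, Ψ (α + β * w + γ * w ^ 2)‖ ^ 2 ≤ Fintype.card R * #{d : R | 2 * γ * d = 0} := by
  have h1 : ((‖∑ w, Ψ (α + β * w + γ * w ^ 2)‖ ^ 2 : ℝ) : ℂ) =
      ∑ d, Ψ (β * d + γ * d ^ 2) * ∑ w, Ψ (w * (2 * γ * d)) := by
    rw [← Complex.normSq_eq_norm_sq, Complex.normSq_eq_conj_mul_self, map_sum, sum_mul_sum]
    have : ∀ w : R, ∑ w', (starRingEnd ℂ) (Ψ (α + β * w + γ * w ^ 2)) *
        Ψ (α + β * w' + γ * w' ^ 2) = ∑ d, Ψ (β * d + γ * d ^ 2) * Ψ (w * (2 * γ * d)) := by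
      intro w
      rw [← Equiv.sum_comp (Equiv.addRight w)]
      refine sum_congr rfl fun d _ ↦ ?_
      rw [← AddChar.map_neg_eq_conj, ← AddChar.map_add_eq_mul, ← AddChar.map_add_eq_mul,
        Equiv.coe_addRight]
      congr 1
      ring
    rw [sum_congr rfl fun w _ ↦ this w, sum_comm]
    simp_rw [mul_sum]
  have h2 : ∀ d, ∑ w, Ψ (w * (2 * γ * d)) = if 2 * γ * d = 0 then (Fintype.card R : ℂ) else 0 :=
    fun d ↦ by simpa using AddChar.sum_mulShift (2 * γ * d) hΨ
  have h3 : ‖((‖∑ w, Ψ (α + β * w + γ * w ^ 2)‖ ^ 2 : ℝ) : ℂ)‖ ≤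
      ∑ d, if 2 * γ * d = 0 then (Fintype.card R : ℝ) else 0 := by
    rw [h1]
    refine (norm_sum_le _ _).trans (sum_le_sum fun d _ ↦ ?_)
    rw [h2, norm_mul, AddChar.norm_apply, one_mul]
    split_ifs <;> simp
  rw [Complex.norm_real, Real.norm_eq_abs, abs_of_nonneg (by positivity)] at h3
  refine h3.trans_eq ?_
  rw [← sum_filter, sum_const, nsmul_eq_mul, mul_comm]

lemma card_mul_kloostermanSum [Fintype Rˣ] {π : R} (hπ : π ^ 3 = 0) (Ψ : AddChar R ℂ) (a b : R) :
    Fintype.card R * kloostermanSum Ψ a b = ∑ u : Rˣ, ∑ w : R,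
      Ψ ((a * u + b * (↑u⁻¹ : R)) + (a * u - b * (↑u⁻¹ : R)) * π * w +
        b * (↑u⁻¹ : R) * π ^ 2 * w ^ 2) := by
  rw [sum_comm, ← nsmul_eq_mul, ← card_univ, ← sum_const]
  refine sum_congr rfl fun w _ ↦ ?_
  have hinv : (1 + π * w) * (1 - π * w + (π * w) ^ 2) = 1 := by
    linear_combination w ^ 3 * hπ
  let v : Rˣ := ⟨1 + π * w, 1 - π * w + (π * w) ^ 2, hinv, by rw [mul_comm, hinv]⟩
  refine (Fintype.sum_equiv (Equiv.mulRight v) _ _ fun u ↦ ?_).symm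
  congr 1
  rw [Equiv.coe_mulRight, mul_inv, Units.val_mul, Units.val_mul]
  change _ = a * (u * (1 + π * w)) + b * (↑u⁻¹ * (1 - π * w + (π * w) ^ 2))
  ring

lemma mul_eq_zero_of_sum_ne_zero {Ψ : AddChar R ℂ} (hΨ : Ψ.IsPrimitive) {α β γ σ : R}
    (hγ : γ * σ = 0) (h : ∑ w, Ψ (α + β * w + γ * w ^ 2) ≠ 0) : β * σ = 0 := by
  by_contra hne
  refine hΨ hne ?_
  ext v
  rw [AddChar.mulShift_apply, AddChar.one_apply]
  have : ∑ w, Ψ (α + β * w + γ * w ^ 2) =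
      Ψ (β * σ * v) * ∑ w, Ψ (α + β * w + γ * w ^ 2) := by
    conv_lhs => rw [← Equiv.sum_comp (Equiv.addRight (σ * v))]
    rw [mul_sum]
    refine sum_congr rfl fun w _ ↦ ?_
    rw [← AddChar.map_add_eq_mul, Equiv.coe_addRight]
    congr 1
    linear_combination (2 * w * v + σ * v ^ 2) * hγ
  exact (mul_eq_right₀ h).mp this.symm

end StationaryPhase

section PrimePower

open Finset

lemma ZMod.card_natCast_mul_eq_zero_le {N m : ℕ} [NeZero N] (hm : 0 < m) :
    #{d : ZMod N | (m : ZMod N) * d = 0} ≤ m := by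
  have := IsAddCyclic.card_nsmul_eq_zero_le (α := ZMod N) hm
  simpa [nsmul_eq_mul] using this

lemma ZMod.isUnit_or_exists_eq_mul {p k : ℕ} (hp : p.Prime) [NeZero (p ^ k)] (x : ZMod (p ^ k)) :
    IsUnit x ∨ ∃ y, x = p * y := by
  rw [← ZMod.natCast_zmod_val x]
  by_cases h : p ∣ x.val
  · right
    obtain ⟨y, hy⟩ := h
    exact ⟨y, by rw [hy]; push_cast; rfl⟩
  · left
    rw [ZMod.isUnit_iff_coprime]
    exact (((hp.coprime_iff_not_dvd).mpr h).pow_left k).symm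

/-- The number of units `u` for which `a u - b u⁻¹` is annihilated by `m`. -/
lemma card_stationary_le {p k m : ℕ} (hp : p.Prime) [NeZero (p ^ k)] (hm : 0 < m)
    {a b : ZMod (p ^ k)} (ha : IsUnit a) :
    #{u : (ZMod (p ^ k))ˣ | (a * u - b * (↑u⁻¹ : ZMod (p ^ k))) * m = 0} ≤ 4 * m := by
  set S : Finset (ZMod (p ^ k))ˣ := {u | (a * u - b * (↑u⁻¹ : ZMod (p ^ k))) * m = 0} with hS
  have hsq : ∀ u ∈ S, a * (u : ZMod (p ^ k)) ^ 2 * m = b * m := by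
    intro u hu
    have := (mem_filter.mp hu).2
    linear_combination (u : ZMod (p ^ k)) * this + (b * m) * u.mul_inv
  rcases S.eq_empty_or_nonempty with h | ⟨u₀, hu₀⟩
  · simp [h]
  have hdich : ∀ t : ZMod (p ^ k), (t - 1) * ((t + 1) * m) = 0 →
      ((2 * m : ℕ) : ZMod (p ^ k)) * (t - 1) = 0 ∨ ((2 * m : ℕ) : ZMod (p ^ k)) * (t + 1) = 0 := by
    intro t ht
    push_cast
    rcases ZMod.isUnit_or_exists_eq_mul hp (t - 1) with h1 | ⟨x, hx⟩
    · right
      linear_combination 2 * (h1.mul_right_eq_zero.mp ht)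
    rcases ZMod.isUnit_or_exists_eq_mul hp (t + 1) with h2 | ⟨y, hy⟩
    · left
      have : (t + 1) * ((t - 1) * m) = 0 := by linear_combination ht
      linear_combination 2 * (h2.mul_right_eq_zero.mp this)
    have htriv : IsUnit (p : ZMod (p ^ k)) → ((2 * m : ZMod (p ^ k))) * (t - 1) = 0 := by
      intro h
      have h0 : IsUnit (0 : ZMod (p ^ k)) := by
        have h1 := h.pow k
        rwa [← Nat.cast_pow, ZMod.natCast_self] at h1
      have : Subsingleton (ZMod (p ^ k)) := isUnit_zero_iff.mp h0 |> subsingleton_of_zero_eq_one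
      exact Subsingleton.elim _ _
    by_cases h2p : p = 2
    · subst h2p
      push_cast at hx hy htriv
      rcases ZMod.isUnit_or_exists_eq_mul hp (x + 1) with h3 | ⟨z, hz⟩
      · left
        refine h3.mul_right_eq_zero.mp ?_
        rw [← ht]
        linear_combination (-m * (t - 1)) * hx
      rcases ZMod.isUnit_or_exists_eq_mul hp x with h4 | ⟨w, hw⟩
      · right
        refine h4.mul_right_eq_zero.mp ?_
        rw [← ht]
        linear_combination (-m * (t + 1)) * hx
      · left
        refine htriv (IsUnit.of_mul_eq_one (z - w) ?_)
        push_cast at hz hw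
        linear_combination hw - hz
    · left
      have h2 : (2 : ZMod (p ^ k)) = p * (y - x) := by linear_combination hy - hx
      have h5 : IsUnit ((2 : ℕ) : ZMod (p ^ k)) := by
        rw [ZMod.isUnit_iff_coprime]
        exact Nat.Coprime.pow_right k
          ((Nat.coprime_primes Nat.prime_two hp).mpr (Ne.symm h2p))
      push_cast at h5
      rw [h2] at h5
      exact htriv (isUnit_of_mul_isUnit_left h5)
  set A : Finset (ZMod (p ^ k)) := {d | ((2 * m : ℕ) : ZMod (p ^ k)) * d = 0} with hA
  have hAc : #A ≤ 2 * m := ZMod.card_natCast_mul_eq_zero_le (by omega)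
  have hmap : S ⊆ (A.image (fun d ↦ (u₀ : ZMod (p ^ k)) * (d + 1)) ∪
      A.image (fun d ↦ (u₀ : ZMod (p ^ k)) * (d - 1))).preimage Units.val
        Units.val_injective.injOn := by
    intro u hu
    have h1 := hsq u hu
    have h2 := hsq u₀ hu₀
    have hinv := u₀.mul_inv
    set t : ZMod (p ^ k) := u * (↑u₀⁻¹ : ZMod (p ^ k)) with ht
    have hut : (u : ZMod (p ^ k)) = u₀ * t := by
      linear_combination (-(u : ZMod (p ^ k))) * hinv
    have h3 : (t - 1) * ((t + 1) * m) = 0 := by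
      have h4 : IsUnit (a * (u₀ : ZMod (p ^ k)) ^ 2) := ha.mul (u₀.isUnit.pow 2)
      refine h4.mul_right_eq_zero.mp ?_
      rw [hut] at h1
      linear_combination h1 - h2
    simp only [mem_preimage, mem_union, mem_image]
    rcases hdich t h3 with h | h
    · exact Or.inl ⟨t - 1, by simpa [hA] using h, by rw [hut]; ring⟩
    · exact Or.inr ⟨t + 1, by simpa [hA] using h, by rw [hut]; ring⟩
  refine (card_le_card hmap).trans ?_
  refine (card_le_card_of_injOn Units.val (fun u hu ↦ ?_) Units.val_injective.injOn
    (t := A.image (fun d ↦ (u₀ : ZMod (p ^ k)) * (d + 1)) ∪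
      A.image (fun d ↦ (u₀ : ZMod (p ^ k)) * (d - 1)))).trans ?_
  · exact mem_preimage.mp hu
  · refine (card_union_le _ _).trans ?_
    have i1 := card_image_le (s := A) (f := fun d ↦ (u₀ : ZMod (p ^ k)) * (d + 1))
    have i2 := card_image_le (s := A) (f := fun d ↦ (u₀ : ZMod (p ^ k)) * (d - 1))
    omega

/-- Kloosterman sums to prime power moduli with exponent at least two. -/
lemma norm_kloostermanSum_prime_pow_le {p k l ε : ℕ} (hp : p.Prime) (hl : 1 ≤ l) (hε : ε ≤ 1)
    (hk : k = 2 * l + ε) [NeZero (p ^ k)] {Ψ : AddChar (ZMod (p ^ k)) ℂ} (hΨ : Ψ.IsPrimitive)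
    {a b : ℤ} (hab : ¬ ((p : ℤ) ∣ a ∧ (p : ℤ) ∣ b)) :
    ‖kloostermanSum Ψ (a : ZMod (p ^ k)) b‖ ≤ 6 * √((p ^ k : ℕ) : ℝ) := by
  have hpk : (p : ZMod (p ^ k)) ^ k = 0 := by rw [← Nat.cast_pow, ZMod.natCast_self]
  have hπ : ((p : ZMod (p ^ k)) ^ l) ^ 3 = 0 := by
    rw [← pow_mul]; exact pow_eq_zero_of_le (by omega) hpk
  have hmain := card_mul_kloostermanSum hπ Ψ (a : ZMod (p ^ k)) b
  set G : (ZMod (p ^ k))ˣ → ℂ := fun u ↦ ∑ w : ZMod (p ^ k),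
      Ψ ((a * u + b * (↑u⁻¹ : ZMod (p ^ k))) + (a * u - b * (↑u⁻¹ : ZMod (p ^ k))) * p ^ l * w +
        b * (↑u⁻¹ : ZMod (p ^ k)) * (p ^ l) ^ 2 * w ^ 2) with hG
  set B : (ZMod (p ^ k))ˣ → ZMod (p ^ k) := fun u ↦ a * u - b * (↑u⁻¹ : ZMod (p ^ k)) with hB
  have hpp : 0 < p := hp.pos
  have hstat : ∀ u, G u ≠ 0 → B u * ((p ^ (l + ε) : ℕ) : ZMod (p ^ k)) = 0 := by
    intro u hu
    have := mul_eq_zero_of_sum_ne_zero hΨ (α := a * u + b * (↑u⁻¹ : ZMod (p ^ k)))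
      (β := B u * p ^ l) (γ := b * (↑u⁻¹ : ZMod (p ^ k)) * (p ^ l) ^ 2)
      (σ := (p : ZMod (p ^ k)) ^ ε) ?_ hu
    · rw [← this]; push_cast; ring
    · have : (p ^ l : ZMod (p ^ k)) ^ 2 * p ^ ε = 0 := by
        rw [← hpk, ← pow_mul, ← pow_add, hk]; ring_nf
      linear_combination (b * (↑u⁻¹ : ZMod (p ^ k))) * this
  have hdvd : ∀ x : ℤ, (x : ZMod (p ^ k)) * ((p ^ (l + ε) : ℕ) : ZMod (p ^ k)) = 0 →
      (p : ℤ) ∣ x := by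
    intro x hx
    have h1 : ((x * (p ^ (l + ε) : ℕ) : ℤ) : ZMod (p ^ k)) = 0 := by push_cast at hx ⊢; exact hx
    rw [ZMod.intCast_zmod_eq_zero_iff_dvd] at h1
    have h2 : p ^ k = p ^ l * p ^ (l + ε) := by rw [← pow_add, hk]; ring_nf
    rw [h2, Nat.cast_mul] at h1
    have h3 := (mul_dvd_mul_iff_right (by positivity)).mp h1
    exact (dvd_pow_self (p : ℤ) (by omega : l ≠ 0)).trans (by simpa using h3)
  have hunit : ∀ x : ℤ, ¬ (p : ℤ) ∣ x → IsUnit (x : ZMod (p ^ k)) := by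
    intro x hx
    rw [ZMod.coe_int_isUnit_iff_isCoprime]
    push_cast
    exact (((Nat.prime_iff_prime_int.mp hp).coprime_iff_not_dvd).mpr hx).pow_left
  by_cases hall : ∀ u, G u = 0
  · have h1 : (Fintype.card (ZMod (p ^ k)) : ℂ) * kloostermanSum Ψ (a : ZMod (p ^ k)) b = 0 := by
      rw [hmain]; exact sum_eq_zero fun u _ ↦ hall u
    rw [mul_eq_zero, or_iff_right (by simp [hp.ne_zero])] at h1
    rw [h1, norm_zero]
    positivity
  push Not at hall
  obtain ⟨u, hu⟩ := hall
  have hu' := hstat u hu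
  have hpint : Prime (p : ℤ) := Nat.prime_iff_prime_int.mp hp
  obtain ⟨ha, hb⟩ : ¬ (p : ℤ) ∣ a ∧ ¬ (p : ℤ) ∣ b := by
    obtain ⟨x, hx⟩ := ZMod.intCast_surjective (u : ZMod (p ^ k))
    obtain ⟨y, hy⟩ := ZMod.intCast_surjective (↑u⁻¹ : ZMod (p ^ k))
    have h1 : (p : ℤ) ∣ a * x - b * y := by
      apply hdvd
      push_cast
      rw [hx, hy]
      simpa [hB] using hu'
    have h2 : (p : ℤ) ∣ x * y - 1 := by
      apply hdvd
      push_cast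
      rw [hx, hy, u.mul_inv]
      ring
    have h3 : ∀ z, (p : ℤ) ∣ x * y * z → (p : ℤ) ∣ z := by
      intro z hz
      have := dvd_sub hz (h2.mul_right z)
      ring_nf at this
      simpa using this
    constructor
    · intro h
      refine hab ⟨h, h3 b ?_⟩
      have := (dvd_sub (h.mul_right x) h1).mul_right x
      ring_nf at this ⊢
      exact this
    · intro h
      refine hab ⟨h3 a ?_, h⟩
      have := (dvd_add h1 (h.mul_right y)).mul_right y
      ring_nf at this ⊢
      exact this
  have hG2 : ∀ u, ‖G u‖ ≤ √(p ^ k * (2 * p ^ (2 * l)) : ℝ) := by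
    intro u
    refine Real.le_sqrt_of_sq_le ?_
    refine (norm_sum_quadratic_sq_le hΨ _ _ _).trans ?_
    rw [ZMod.card]
    push_cast
    gcongr
    have hc : #{d : ZMod (p ^ k) | 2 * (b * (↑u⁻¹ : ZMod (p ^ k)) * (p ^ l) ^ 2) * d = 0} ≤
        2 * p ^ (2 * l) := by
      refine (card_le_card fun d hd ↦ ?_).trans
        (ZMod.card_natCast_mul_eq_zero_le (N := p ^ k) (m := 2 * p ^ (2 * l)) (by positivity))
      simp only [mem_filter, mem_univ, true_and] at hd ⊢
      refine ((hunit b hb).mul u⁻¹.isUnit).mul_right_eq_zero.mp ?_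
      rw [← hd]
      push_cast
      ring
    exact_mod_cast hc
  have hS : #{u | G u ≠ 0} ≤ 4 * p ^ (l + ε) := by
    refine (card_le_card fun u hu ↦ ?_).trans
      (card_stationary_le (b := (b : ZMod (p ^ k))) hp (by positivity) (hunit a ha))
    simp only [mem_filter, mem_univ, true_and] at hu ⊢
    exact hstat u hu
  have hS' : (#{u | G u ≠ 0} : ℝ) ≤ 4 * p ^ (l + ε) := by exact_mod_cast hS
  have h1 : (p : ℝ) ^ k * ‖kloostermanSum Ψ (a : ZMod (p ^ k)) b‖ ≤
      4 * p ^ (l + ε) * √(p ^ k * (2 * p ^ (2 * l)) : ℝ) := by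
    have h2 := congrArg norm hmain
    rw [norm_mul, Complex.norm_natCast, ZMod.card, Nat.cast_pow] at h2
    rw [h2]
    change ‖∑ u, G u‖ ≤ _
    rw [← sum_filter_ne_zero]
    refine (norm_sum_le_of_le _ fun u _ ↦ hG2 u).trans ?_
    rw [sum_const, nsmul_eq_mul]
    gcongr
  have hp0 : (0 : ℝ) < p := by exact_mod_cast hpp
  have h2 := pow_le_pow_left₀ (by positivity) h1 2
  rw [mul_pow, mul_pow, Real.sq_sqrt (by positivity)] at h2
  have h3 : (4 * (p : ℝ) ^ (l + ε)) ^ 2 * (p ^ k * (2 * p ^ (2 * l))) =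
      ((p : ℝ) ^ k) ^ 2 * (32 * p ^ k) := by
    rw [hk]; ring
  rw [h3] at h2
  have h4 := le_of_mul_le_mul_left h2 (by positivity)
  refine abs_le_of_sq_le_sq' ?_ (by positivity) |>.2
  rw [mul_pow, Real.sq_sqrt (by positivity)]
  push_cast
  have : (0 : ℝ) < p ^ k := by positivity
  linarith

end PrimePower

section GeneralModulus

open Finset

lemma kloostermanSum_zero_left {F : Type*} [Field F] [Fintype F] [DecidableEq F]
    {Ψ : AddChar F ℂ} (hΨ : Ψ.IsPrimitive) {b : F} (hb : b ≠ 0) : kloostermanSum Ψ 0 b = -1 := by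
  rw [kloostermanSum_comm]
  unfold kloostermanSum
  have h1 : ∑ x : F, Ψ (x * b) = 0 := by simpa [hb] using AddChar.sum_mulShift b hΨ
  rw [← add_sum_erase _ _ (mem_univ (0 : F)), zero_mul, AddChar.map_zero_eq_one] at h1
  have h2 : ∑ u : Fˣ, Ψ (b * u + 0 * (↑u⁻¹ : F)) = ∑ x ∈ univ.erase (0 : F), Ψ (x * b) := by
    refine sum_bij (fun u _ ↦ (u : F)) (by simp) (fun _ _ _ _ h ↦ Units.ext h) ?_ ?_
    · intro x hx
      exact ⟨Units.mk0 x (ne_of_mem_erase hx), mem_univ _, rfl⟩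
    · intro u _
      rw [zero_mul, add_zero, mul_comm]
  rw [h2]
  linear_combination h1

lemma norm_kloostermanSum_prime_le_of_not_both_zero {p : ℕ} [Fact p.Prime] {Ψ : AddChar (ZMod p) ℂ}
    (hΨ : Ψ.IsPrimitive) {a b : ZMod p} (hab : ¬ (a = 0 ∧ b = 0)) :
    ‖kloostermanSum Ψ a b‖ ≤ 2 * √p := by
  have hp1 : (1 : ℝ) ≤ √p := by
    rw [Real.one_le_sqrt]; exact_mod_cast (Fact.out : p.Prime).one_le
  by_cases ha : a = 0
  · rw [ha, kloostermanSum_zero_left hΨ (fun h ↦ hab ⟨ha, h⟩), norm_neg, norm_one]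
    linarith
  by_cases hb : b = 0
  · rw [kloostermanSum_comm, hb, kloostermanSum_zero_left hΨ ha, norm_neg, norm_one]
    linarith
  have hne : Ψ ≠ 1 := by
    have := hΨ one_ne_zero
    rwa [AddChar.mulShift_one] at this
  exact norm_kloostermanSum_prime_le hne ha hb

lemma norm_kloostermanSum_prime_pow_gcd_le {p : ℕ} (hp : p.Prime) [NeZero p] (k : ℕ)
    {Ψ : AddChar (ZMod (p ^ k)) ℂ} (hΨ : Ψ.IsPrimitive) (a b : ℤ) :
    ‖kloostermanSum Ψ (a : ZMod (p ^ k)) b‖ ≤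
      6 * √((p ^ k : ℕ) : ℝ) * ((a.gcd b).gcd (p ^ k) : ℕ) := by
  induction k generalizing a b with
  | zero =>
    refine (norm_kloostermanSum_le_card _ _ _).trans ?_
    rw [ZMod.card_units_eq_totient]
    norm_num
  | succ k ih =>
    by_cases hab : (p : ℤ) ∣ a ∧ (p : ℤ) ∣ b
    · obtain ⟨⟨a, rfl⟩, ⟨b, rfl⟩⟩ := hab
      have hpk : p ^ (k + 1) = p * p ^ k := pow_succ' p k
      have hgen : ∀ (N : ℕ) (hN : N = p * p ^ k) [NeZero N] (Ψ : AddChar (ZMod N) ℂ),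
          Ψ.IsPrimitive → ‖kloostermanSum Ψ ((p * a : ℤ) : ZMod N) ((p * b : ℤ) : ZMod N)‖ ≤
          p * (6 * √((p ^ k : ℕ) : ℝ) * ((a.gcd b).gcd (p ^ k) : ℕ)) := by
        rintro N rfl _ Ψ hΨ
        refine (norm_kloostermanSum_mul_le hp Ψ a b).trans ?_
        gcongr
        exact ih (isPrimitive_comp_mulLeftHom hp.ne_zero hΨ) a b
      refine (hgen _ hpk Ψ hΨ).trans ?_
      have hg : ((p * a).gcd (p * b)).gcd (p ^ (k + 1)) = p * (a.gcd b).gcd (p ^ k) := by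
        rw [Int.gcd_mul_left, Int.natAbs_natCast, hpk, Nat.gcd_mul_left]
      rw [hg]
      have hle : √((p ^ k : ℕ) : ℝ) ≤ √((p ^ (k + 1) : ℕ) : ℝ) := by
        gcongr
        · exact hp.one_le
        · omega
      push_cast at hle ⊢
      calc _ = 6 * √((p : ℝ) ^ k) * (p * ((a.gcd b).gcd (p ^ k) : ℕ)) := by ring
        _ ≤ _ := by gcongr
    · have hg : (1 : ℝ) ≤ ((a.gcd b).gcd (p ^ (k + 1)) : ℕ) := by
        exact_mod_cast Nat.gcd_pos_of_pos_right _ (NeZero.pos _)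
      refine le_trans ?_ (le_mul_of_one_le_right (by positivity) hg)
      rcases Nat.eq_zero_or_pos k with rfl | hk
      · have : Fact p.Prime := ⟨hp⟩
        have hgen : ∀ (N : ℕ) (hN : N = p) [NeZero N] (Ψ : AddChar (ZMod N) ℂ),
            Ψ.IsPrimitive → ‖kloostermanSum Ψ (a : ZMod N) (b : ZMod N)‖ ≤ 2 * √(N : ℝ) := by
          rintro N rfl _ Ψ hΨ
          have := norm_kloostermanSum_prime_le_of_not_both_zero hΨ (a := (a : ZMod N)) (b := b) (by
            rwa [ZMod.intCast_zmod_eq_zero_iff_dvd, ZMod.intCast_zmod_eq_zero_iff_dvd])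
          convert this
        refine (hgen _ (by simp) Ψ hΨ).trans ?_
        gcongr
        norm_num
      · exact norm_kloostermanSum_prime_pow_le hp (l := (k + 1) / 2) (ε := (k + 1) % 2)
          (by omega) (by omega) (by omega) hΨ hab

/-- **Weil's bound** for Kloosterman sums to a general modulus, with a crude constant. -/
theorem norm_kloostermanSum_le {q : ℕ} [NeZero q] {Ψ : AddChar (ZMod q) ℂ}
    (hΨ : Ψ.IsPrimitive) (a b : ℤ) :
    ‖kloostermanSum Ψ (a : ZMod q) b‖ ≤
      6 ^ q.primeFactors.card * √(q : ℝ) * ((a.gcd b).gcd q : ℕ) := by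
  have main : ∀ q : ℕ, ∀ [NeZero q] (Ψ : AddChar (ZMod q) ℂ), Ψ.IsPrimitive →
      ‖kloostermanSum Ψ (a : ZMod q) b‖ ≤
      6 ^ q.primeFactors.card * √(q : ℝ) * ((a.gcd b).gcd q : ℕ) := by
    intro q
    induction q using Nat.recOnPosPrimePosCoprime with
    | zero => intro h; exact absurd rfl h.ne
    | one =>
      intro _ Ψ _
      refine (norm_kloostermanSum_le_card _ _ _).trans ?_
      rw [ZMod.card_units_eq_totient]
      norm_num
    | prime_pow p k hp hk =>
      intro _ Ψ hΨ
      rw [Nat.primeFactors_prime_pow hk.ne' hp, card_singleton, pow_one]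
      have : NeZero p := ⟨hp.ne_zero⟩
      exact norm_kloostermanSum_prime_pow_gcd_le hp k hΨ a b
    | coprime m n hm hn hmn ihm ihn =>
      intro _ Ψ hΨ
      have : NeZero m := ⟨by omega⟩
      have : NeZero n := ⟨by omega⟩
      obtain ⟨Ψ₁, Ψ₂, h1, h2, h⟩ := exists_kloostermanSum_eq_mul hmn hΨ a b
      rw [h, norm_mul, hmn.gcd_mul, hmn.primeFactors_mul,
        card_union_of_disjoint hmn.disjoint_primeFactors, pow_add]
      refine (mul_le_mul (ihm Ψ₁ h1) (ihn Ψ₂ h2) (norm_nonneg _) (by positivity)).trans_eq ?_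
      push_cast
      rw [Real.sqrt_mul (Nat.cast_nonneg m)]
      ring
  exact main q Ψ hΨ

end GeneralModulus

section DivisorBounds

open Finset

lemma exists_pow_card_primeFactors_le {c : ℝ} (hc : 1 ≤ c) {δ : ℝ} (hδ : 0 < δ) :
    ∃ C : ℝ, 1 ≤ C ∧ ∀ q : ℕ, q ≠ 0 → c ^ q.primeFactors.card ≤ C * (q : ℝ) ^ δ := by
  obtain ⟨P, hP⟩ := exists_nat_ge (c ^ δ⁻¹)
  refine ⟨c ^ P, one_le_pow₀ hc, fun q hq ↦ ?_⟩
  have hP' : ∀ p : ℕ, P ≤ p → c ≤ (p : ℝ) ^ δ := fun p hp ↦ by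
    have h : c ^ δ⁻¹ ≤ (p : ℝ) := hP.trans (by exact_mod_cast hp)
    calc c = (c ^ δ⁻¹) ^ δ := by
          rw [← Real.rpow_mul (by linarith), inv_mul_cancel₀ hδ.ne', Real.rpow_one]
      _ ≤ _ := by gcongr
  have h1 : ∀ p ∈ q.primeFactors, c ≤ (if p < P then c else 1) * (p : ℝ) ^ δ := by
    intro p hp
    have : (1 : ℝ) ≤ (p : ℝ) ^ δ :=
      Real.one_le_rpow (by exact_mod_cast (Nat.prime_of_mem_primeFactors hp).one_le) hδ.le
    split_ifs with h
    · exact le_mul_of_one_le_right (by linarith) this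
    · rw [one_mul]; exact hP' p (by omega)
  calc c ^ q.primeFactors.card = ∏ p ∈ q.primeFactors, c := by rw [prod_const]
    _ ≤ ∏ p ∈ q.primeFactors, ((if p < P then c else 1) * (p : ℝ) ^ δ) :=
        prod_le_prod (fun _ _ ↦ by linarith) h1
    _ = c ^ #{p ∈ q.primeFactors | p < P} * ((∏ p ∈ q.primeFactors, p : ℕ) : ℝ) ^ δ := by
        rw [prod_mul_distrib, ← prod_filter, prod_const, Nat.cast_prod,
          Real.finsetProd_rpow _ _ fun _ _ ↦ by positivity]
    _ ≤ c ^ P * (q : ℝ) ^ δ := by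
        gcongr
        · refine (card_le_card (t := range P) fun p hp ↦ ?_).trans_eq (card_range P)
          exact mem_range.mpr (mem_filter.mp hp).2
        · exact Nat.le_of_dvd (Nat.pos_of_ne_zero hq) (Nat.prod_primeFactors_dvd q)

lemma exists_card_divisors_le {δ : ℝ} (hδ : 0 < δ) :
    ∃ C : ℝ, 1 ≤ C ∧ ∀ q : ℕ, q ≠ 0 → (q.divisors.card : ℝ) ≤ C * (q : ℝ) ^ δ := by
  have h2δ : 0 < δ / 2 := by positivity
  set K : ℝ := 1 + 1 / (δ / 2 * Real.log 2) with hK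
  have hlog2 : 0 < Real.log 2 := Real.log_pos (by norm_num)
  have hK1 : 1 ≤ K := by rw [hK]; simp; positivity
  obtain ⟨C, hC1, hC⟩ := exists_pow_card_primeFactors_le hK1 h2δ
  refine ⟨C, hC1, fun q hq ↦ ?_⟩
  have hfac : ∀ p ∈ q.primeFactors, ((q.factorization p + 1 : ℕ) : ℝ) ≤
      K * ((p ^ q.factorization p : ℕ) : ℝ) ^ (δ / 2) := by
    intro p hp
    set v := q.factorization p
    have hp2 : (2 : ℝ) ≤ p := by exact_mod_cast (Nat.prime_of_mem_primeFactors hp).two_le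
    have e1 : (2 : ℝ) ^ (v * (δ / 2)) ≤ ((p ^ v : ℕ) : ℝ) ^ (δ / 2) := by
      push_cast
      rw [Real.rpow_mul (by norm_num), Real.rpow_natCast]
      gcongr
    have e2 : 1 + v * (δ / 2) * Real.log 2 ≤ (2 : ℝ) ^ (v * (δ / 2)) := by
      rw [Real.rpow_def_of_pos (by norm_num)]
      have := Real.add_one_le_exp (Real.log 2 * (v * (δ / 2)))
      linarith
    have e3 : ((v + 1 : ℕ) : ℝ) ≤ K * (1 + v * (δ / 2) * Real.log 2) := by
      have : K * (1 + v * (δ / 2) * Real.log 2) =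
          1 + v + (v * (δ / 2) * Real.log 2 + 1 / (δ / 2 * Real.log 2)) := by
        rw [hK]; field_simp; ring
      rw [this]
      push_cast
      have : 0 ≤ v * (δ / 2) * Real.log 2 + 1 / (δ / 2 * Real.log 2) := by positivity
      linarith
    refine e3.trans ?_
    gcongr
    exact e2.trans e1
  calc (q.divisors.card : ℝ) = ∏ p ∈ q.primeFactors, ((q.factorization p + 1 : ℕ) : ℝ) := by
        rw [Nat.card_divisors hq, Nat.cast_prod]
    _ ≤ ∏ p ∈ q.primeFactors, (K * ((p ^ q.factorization p : ℕ) : ℝ) ^ (δ / 2)) :=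
        prod_le_prod (fun _ _ ↦ by positivity) hfac
    _ = K ^ q.primeFactors.card * (q : ℝ) ^ (δ / 2) := by
        rw [prod_mul_distrib, prod_const, Real.finsetProd_rpow _ _ fun _ _ ↦ by positivity,
          ← Nat.cast_prod]
        congr 3
        exact Nat.prod_factorization_pow_eq_self hq
    _ ≤ C * (q : ℝ) ^ (δ / 2) * (q : ℝ) ^ (δ / 2) := by
        gcongr; exact hC q hq
    _ = C * (q : ℝ) ^ δ := by
        rw [mul_assoc, ← Real.rpow_add (by positivity), add_halves]

end DivisorBounds

section ExponentialSums

open Finset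

/-- The incomplete character sum over a finite set of integers. -/
noncomputable def incompleteSum {q : ℕ} (Ψ : AddChar (ZMod q) ℂ) (S : Finset ℤ) (s : ZMod q) : ℂ :=
  ∑ a ∈ S, Ψ (s * (a : ZMod q))

lemma sum_addChar_ite {q : ℕ} [NeZero q] {Ψ : AddChar (ZMod q) ℂ} (hΨ : Ψ.IsPrimitive)
    (x y : ZMod q) : ∑ s, Ψ (s * x) * Ψ (-(s * y)) = if x = y then (q : ℂ) else 0 := by
  have := AddChar.sum_mulShift (x - y) hΨ
  rw [ZMod.card] at this
  simp_rw [sub_eq_zero] at this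
  push_cast at this
  rw [← this]
  refine sum_congr rfl fun s _ ↦ ?_
  rw [← AddChar.map_add_eq_mul]
  congr 1
  ring

lemma sq_mul_card_eq_sum_kloostermanSum {q : ℕ} [NeZero q] {Ψ : AddChar (ZMod q) ℂ}
    (hΨ : Ψ.IsPrimitive) (S S' : Finset ℤ) (h : ℤ) :
    (q : ℂ) ^ 2 * #{p ∈ S ×ˢ S' | p.1 * p.2 ≡ h [ZMOD (q : ℤ)] ∧ Int.gcd p.2 q = 1} =
      ∑ s, ∑ t, incompleteSum Ψ S s * incompleteSum Ψ S' t *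
        kloostermanSum Ψ (-t) (-(s * (h : ZMod q))) := by
  have h1 : ∀ p : ℤ × ℤ, (if p.1 * p.2 ≡ h [ZMOD (q : ℤ)] ∧ Int.gcd p.2 q = 1 then 1 else 0 : ℂ) =
      ∑ u : (ZMod q)ˣ, (if (p.1 : ZMod q) = h * (↑u⁻¹ : ZMod q) then 1 else 0) *
        (if (p.2 : ZMod q) = u then 1 else 0) := by
    rintro ⟨a, b⟩
    have hcop : Int.gcd b q = 1 ↔ IsUnit (b : ZMod q) := by
      rw [ZMod.coe_int_isUnit_iff_isCoprime, Int.isCoprime_iff_gcd_eq_one, Int.gcd_comm]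
    have hcong : a * b ≡ h [ZMOD (q : ℤ)] ↔ (a : ZMod q) * b = h := by
      rw [← ZMod.intCast_eq_intCast_iff]; push_cast; rfl
    simp only [hcop, hcong]
    by_cases hb : IsUnit (b : ZMod q)
    · obtain ⟨v, hv⟩ := hb
      rw [← hv, sum_eq_single v]
      · have : (a : ZMod q) * v = h ↔ (a : ZMod q) = h * (↑v⁻¹ : ZMod q) :=
          (Units.eq_mul_inv_iff_mul_eq v).symm
        simp [this]
      · intro u _ hu
        rw [if_neg (fun h ↦ hu (Units.ext h).symm), mul_zero]
      · simp
    · rw [if_neg (fun h ↦ hb h.2), sum_eq_zero]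
      intro u _
      rw [if_neg (c := (b : ZMod q) = u) (fun h ↦ hb (h ▸ u.isUnit)), mul_zero]
  have h2 : ((#{p ∈ S ×ˢ S' | p.1 * p.2 ≡ h [ZMOD (q : ℤ)] ∧ Int.gcd p.2 q = 1} : ℕ) : ℂ) =
      ∑ u : (ZMod q)ˣ, (∑ a ∈ S, if (a : ZMod q) = h * (↑u⁻¹ : ZMod q) then 1 else 0) *
        (∑ b ∈ S', if (b : ZMod q) = u then 1 else 0) := by
    rw [card_filter]
    push_cast
    simp_rw [h1]
    rw [sum_comm]
    refine sum_congr rfl fun u _ ↦ ?_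
    rw [sum_mul_sum, sum_product]
  have h3 : ∀ (S : Finset ℤ) (x : ZMod q), (q : ℂ) * ∑ a ∈ S, (if (a : ZMod q) = x then 1 else 0) =
      ∑ s, incompleteSum Ψ S s * Ψ (-(s * x)) := by
    intro S x
    simp_rw [incompleteSum, sum_mul]
    rw [sum_comm, mul_sum]
    refine sum_congr rfl fun a _ ↦ ?_
    rw [sum_addChar_ite hΨ]
    simp
  rw [h2, mul_sum]
  have h4 : ∀ u : (ZMod q)ˣ, (q : ℂ) ^ 2 *
      ((∑ a ∈ S, if (a : ZMod q) = h * (↑u⁻¹ : ZMod q) then 1 else 0) *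
        (∑ b ∈ S', if (b : ZMod q) = u then 1 else 0)) =
      ∑ s, ∑ t, incompleteSum Ψ S s * incompleteSum Ψ S' t *
        Ψ (-t * u + -(s * (h : ZMod q)) * (↑u⁻¹ : ZMod q)) := by
    intro u
    rw [show ∀ x y : ℂ, (q : ℂ) ^ 2 * (x * y) = (q * x) * (q * y) by intros; ring, h3, h3,
      sum_mul_sum]
    refine sum_congr rfl fun s _ ↦ sum_congr rfl fun t _ ↦ ?_
    rw [mul_mul_mul_comm, ← AddChar.map_add_eq_mul]
    congr 2
    ring
  rw [sum_congr rfl fun u _ ↦ h4 u, sum_comm]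
  refine sum_congr rfl fun s _ ↦ ?_
  rw [sum_comm]
  refine sum_congr rfl fun t _ ↦ ?_
  rw [kloostermanSum, mul_sum]

lemma norm_stdAddChar_sub_one_ge {q : ℕ} [NeZero q] (s : ZMod q) :
    4 * min (s.val : ℝ) (q - s.val) / q ≤ ‖ZMod.stdAddChar s - 1‖ := by
  have hq : (0 : ℝ) < q := by exact_mod_cast NeZero.pos q
  have hsq : (s.val : ℝ) ≤ q := by exact_mod_cast s.val_lt.le
  have h1 : ZMod.stdAddChar s = Complex.exp (Complex.I * (2 * Real.pi * (s.val / q) : ℝ)) := by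
    have := ZMod.stdAddChar_coe (N := q) s.val
    rw [Int.cast_natCast, ZMod.natCast_zmod_val] at this
    rw [this]
    congr 1
    push_cast
    ring
  rw [h1, Complex.norm_exp_I_mul_ofReal_sub_one]
  have h2 : 2 * Real.pi * (s.val / q) / 2 = Real.pi * (s.val / q) := by ring
  rw [h2, Real.norm_eq_abs, abs_mul, abs_two]
  have key : 2 * min (s.val : ℝ) (q - s.val) / q ≤ Real.sin (Real.pi * (s.val / q)) := by
    rcases le_total (s.val : ℝ) (q / 2) with h | h
    · have := Real.mul_le_sin (x := Real.pi * (s.val / q)) (by positivity) (by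
        have : (s.val : ℝ) / q ≤ 1 / 2 := by rw [div_le_iff₀ hq]; linarith
        nlinarith [Real.pi_pos])
      refine le_trans ?_ this
      rw [min_eq_left (by linarith)]
      apply le_of_eq
      field_simp
    · have h5 : (q - s.val : ℝ) / q ≤ 1 / 2 := by rw [div_le_iff₀ hq]; linarith
      have h6 : 0 ≤ (q - s.val : ℝ) / q := div_nonneg (by linarith) hq.le
      have := Real.mul_le_sin (x := Real.pi * ((q - s.val) / q)) (by positivity)
        (by nlinarith [Real.pi_pos])
      have h7 : Real.pi * ((q - s.val) / q) = Real.pi - Real.pi * (s.val / q) := by field_simp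
      rw [h7, Real.sin_pi_sub, ← h7] at this
      refine le_trans ?_ this
      rw [min_eq_right (by linarith)]
      apply le_of_eq
      field_simp
  have := key.trans (le_abs_self _)
  calc _ = 2 * (2 * min (s.val : ℝ) (q - s.val) / q) := by ring
    _ ≤ _ := by gcongr

lemma norm_incompleteSum_le {q : ℕ} [NeZero q] (A : ℤ) (n : ℕ) {s : ZMod q} (hs : s ≠ 0) :
    ‖incompleteSum ZMod.stdAddChar (Ico A (A + n)) s‖ ≤
      q * (1 / s.val + 1 / ((q : ℝ) - s.val)) := by
  have hq : (0 : ℝ) < q := by exact_mod_cast NeZero.pos q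
  have hs0 : (0 : ℝ) < s.val := by
    exact_mod_cast Nat.pos_of_ne_zero ((ZMod.val_ne_zero s).mpr hs)
  have hsq : (0 : ℝ) < q - s.val := by
    have : (s.val : ℝ) < q := by exact_mod_cast s.val_lt
    linarith
  have hgeom : ∀ n : ℕ, incompleteSum ZMod.stdAddChar (Ico A (A + n)) s * (ZMod.stdAddChar s - 1) =
      ZMod.stdAddChar (s * ((A + n : ℤ) : ZMod q)) - ZMod.stdAddChar (s * (A : ZMod q)) := by
    intro n
    induction n with
    | zero => simp [incompleteSum]
    | succ n ih =>
      have h1 : Ico A (A + (n + 1 : ℕ)) = insert (A + n) (Ico A (A + n)) := by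
        ext x; simp only [mem_Ico, mem_insert]; push_cast; omega
      have h2 : incompleteSum ZMod.stdAddChar (Ico A (A + (n + 1 : ℕ))) s =
          ZMod.stdAddChar (s * ((A + n : ℤ) : ZMod q)) +
          incompleteSum ZMod.stdAddChar (Ico A (A + n)) s := by
        rw [h1, incompleteSum, sum_insert (by simp)]; rfl
      rw [h2, add_mul, ih, mul_sub, ← AddChar.map_add_eq_mul]
      have : s * ((A + n : ℤ) : ZMod q) + s = s * ((A + (n + 1 : ℕ) : ℤ) : ZMod q) := by
        push_cast; ring
      rw [this]
      ring
  have h1 : ‖incompleteSum ZMod.stdAddChar (Ico A (A + n)) s‖ * ‖ZMod.stdAddChar s - 1‖ ≤ 2 := by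
    rw [← norm_mul, hgeom]
    refine (norm_sub_le _ _).trans ?_
    rw [AddChar.norm_apply, AddChar.norm_apply]
    norm_num
  have hmin : 0 < min (s.val : ℝ) (q - s.val) := lt_min hs0 hsq
  have h2 : ‖incompleteSum ZMod.stdAddChar (Ico A (A + n)) s‖ *
      (4 * min (s.val : ℝ) (q - s.val) / q) ≤ 2 :=
    (mul_le_mul_of_nonneg_left (norm_stdAddChar_sub_one_ge s) (norm_nonneg _)).trans h1
  rw [← le_div_iff₀ (by positivity)] at h2
  refine h2.trans ?_
  have h3 : 1 / min (s.val : ℝ) (q - s.val) ≤ 1 / s.val + 1 / ((q : ℝ) - s.val) := by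
    rcases min_choice (s.val : ℝ) (q - s.val) with h | h <;> rw [h]
    · exact le_add_of_nonneg_right (by positivity)
    · exact le_add_of_nonneg_left (by positivity)
  calc 2 / (4 * min (s.val : ℝ) (q - s.val) / q) = q * (1 / min (s.val : ℝ) (q - s.val)) / 2 := by
        field_simp; norm_num
    _ ≤ q * (1 / min (s.val : ℝ) (q - s.val)) := half_le_self (by positivity)
    _ ≤ _ := by gcongr

lemma sum_gcd_div_le (q : ℕ) (hq : q ≠ 0) :
    ∑ r ∈ Ico 1 q, (r.gcd q : ℝ) / r ≤ q.divisors.card * (1 + Real.log q) := by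
  have hharm : ∀ n ≤ q, ∑ k ∈ Icc 1 n, (1 / k : ℝ) ≤ 1 + Real.log q := by
    intro n hn
    rcases Nat.eq_zero_or_pos n with rfl | hn0
    · simpa using Real.log_natCast_nonneg q |>.trans (by linarith)
    have := harmonic_le_one_add_log n
    rw [harmonic_eq_sum_Icc] at this
    push_cast at this
    simp only [one_div]
    refine this.trans ?_
    gcongr
  have h1 : ∀ r ∈ Ico 1 q, (r.gcd q : ℝ) / r ≤
      ∑ d ∈ q.divisors, if d ∣ r then (d : ℝ) / r else 0 := by
    intro r hr
    have hmem : r.gcd q ∈ q.divisors := Nat.mem_divisors.mpr ⟨Nat.gcd_dvd_right _ _, hq⟩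
    refine le_trans ?_ (single_le_sum (fun d _ ↦ ?_) hmem)
    · rw [if_pos (Nat.gcd_dvd_left _ _)]
    · split_ifs <;> positivity
  refine (sum_le_sum h1).trans ?_
  rw [sum_comm, ← nsmul_eq_mul]
  refine sum_le_card_nsmul _ _ _ fun d hd ↦ ?_
  have hd0 : 0 < d := Nat.pos_of_mem_divisors hd
  refine le_trans ?_ (hharm (q / d) (Nat.div_le_self _ _))
  rw [← sum_filter]
  have h2 : ∀ r ∈ (Ico 1 q).filter (d ∣ ·), (d : ℝ) / r = 1 / ((r / d : ℕ) : ℝ) := by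
    intro r hr
    obtain ⟨k, rfl⟩ := (mem_filter.mp hr).2
    rw [Nat.mul_div_cancel_left _ hd0]
    push_cast
    field_simp
  rw [sum_congr rfl h2]
  have hinj : Set.InjOn (fun r ↦ r / d) ((Ico 1 q).filter (d ∣ ·) : Finset ℕ) := by
    intro r hr r' hr' h
    rw [mem_coe, mem_filter] at hr hr'
    exact (Nat.div_left_inj hr.2 hr'.2).mp h
  rw [← sum_image (f := fun k : ℕ ↦ (1 : ℝ) / k) hinj]
  refine sum_le_sum_of_subset_of_nonneg ?_ fun _ _ _ ↦ by positivity
  intro k hk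
  obtain ⟨r, hr, rfl⟩ := mem_image.mp hk
  rw [mem_filter, mem_Ico] at hr
  rw [mem_Icc]
  exact ⟨Nat.div_pos (Nat.le_of_dvd (by omega) hr.2) hd0, Nat.div_le_div_right hr.1.2.le⟩

lemma sum_weight_gcd_le (q : ℕ) [NeZero q] :
    ∑ s ∈ univ.erase (0 : ZMod q), (1 / (s.val : ℝ) + 1 / ((q : ℝ) - s.val)) * (s.val.gcd q : ℝ) ≤
      2 * q.divisors.card * (1 + Real.log q) := by
  have h1 : ∑ s ∈ univ.erase (0 : ZMod q),
      (1 / (s.val : ℝ) + 1 / ((q : ℝ) - s.val)) * (s.val.gcd q : ℝ) =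
      ∑ r ∈ Ico 1 q, (1 / (r : ℝ) + 1 / ((q : ℝ) - r)) * (r.gcd q : ℝ) := by
    refine sum_bij (fun s _ ↦ s.val) ?_ ?_ ?_ ?_
    · intro s hs
      rw [mem_Ico]
      exact ⟨Nat.pos_of_ne_zero ((ZMod.val_ne_zero s).mpr (ne_of_mem_erase hs)), s.val_lt⟩
    · intro s _ t _ h
      exact ZMod.val_injective q h
    · intro r hr
      rw [mem_Ico] at hr
      have : (r : ZMod q).val = r := ZMod.val_cast_of_lt hr.2
      refine ⟨r, mem_erase.mpr ⟨fun h ↦ ?_, mem_univ _⟩, this⟩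
      rw [h, ZMod.val_zero] at this
      omega
    · intro _ _; rfl
  have h2 : ∑ r ∈ Ico 1 q, 1 / ((q : ℝ) - r) * (r.gcd q : ℝ) =
      ∑ r ∈ Ico 1 q, (r.gcd q : ℝ) / r := by
    refine sum_bij (fun r _ ↦ q - r) ?_ ?_ ?_ ?_
    · intro r hr; rw [mem_Ico] at *; omega
    · intro r hr r' hr' h; rw [mem_Ico] at *; omega
    · intro r hr; rw [mem_Ico] at hr; exact ⟨q - r, by rw [mem_Ico]; omega, by omega⟩
    · intro r hr
      rw [mem_Ico] at hr
      rw [Nat.cast_sub hr.2.le, Nat.gcd_self_sub_left hr.2.le, Nat.gcd_comm]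
      ring
  rw [h1]
  simp_rw [add_mul]
  rw [sum_add_distrib, h2]
  have h3 : ∑ r ∈ Ico 1 q, 1 / (r : ℝ) * (r.gcd q : ℝ) = ∑ r ∈ Ico 1 q, (r.gcd q : ℝ) / r :=
    sum_congr rfl fun _ _ ↦ by ring
  rw [h3]
  linarith [sum_gcd_div_le q (NeZero.ne q)]

end ExponentialSums

section DiscreteBox

open Finset

lemma abs_card_congruence_box_sub_le {q : ℕ} [NeZero q] (h A B : ℤ) {n m : ℕ} (hn : n ≤ q)
    (hm : m ≤ q) {L : ℝ} (hL : 2 * q.divisors.card * (1 + Real.log q) ≤ L) :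
    |(#{p ∈ Ico A (A + n) ×ˢ Ico B (B + m) | p.1 * p.2 ≡ h [ZMOD (q : ℤ)] ∧ Int.gcd p.2 q = 1} : ℝ)
      - q.totient / (q : ℝ) ^ 2 * (n * m)| ≤
      6 ^ q.primeFactors.card * √(q : ℝ) * (Int.gcd h q : ℝ) * (2 * L + L ^ 2) := by
  set Ψ : AddChar (ZMod q) ℂ := ZMod.stdAddChar with hΨ
  have hprim : Ψ.IsPrimitive := ZMod.isPrimitive_stdAddChar q
  set D := incompleteSum Ψ (Ico A (A + n)) with hD
  set D' := incompleteSum Ψ (Ico B (B + m)) with hD'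
  set K : ZMod q → ZMod q → ℂ := fun s t ↦ kloostermanSum Ψ (-t) (-(s * (h : ZMod q))) with hK
  set M : ℝ := 6 ^ q.primeFactors.card * √(q : ℝ) with hM
  set g : ℝ := (Int.gcd h q : ℝ) with hg
  have hq : (0 : ℝ) < q := by exact_mod_cast NeZero.pos q
  have hg1 : 1 ≤ g := by
    rw [hg]; exact_mod_cast Int.gcd_pos_of_ne_zero_right _ (by exact_mod_cast NeZero.ne q)
  have hM0 : 0 ≤ M := by positivity
  set e : ZMod q → ℝ := fun s ↦ 1 / (s.val : ℝ) + 1 / ((q : ℝ) - s.val) with he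
  have he0 : ∀ s, 0 ≤ e s := fun s ↦ by
    have : (0 : ℝ) ≤ q - s.val := by
      rw [sub_nonneg]; exact_mod_cast s.val_lt.le
    positivity
  have hgs : ∀ s : ZMod q, 1 ≤ (s.val.gcd q : ℝ) := fun s ↦ by
    exact_mod_cast Nat.gcd_pos_of_pos_right _ (NeZero.pos q)
  have hKint : ∀ s t, ‖K s t‖ ≤ M * (((-(t.val : ℤ)).gcd (-(s.val * h))).gcd q : ℕ) := by
    intro s t
    have := norm_kloostermanSum_le hprim (-(t.val : ℤ)) (-(s.val * h))
    push_cast at this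
    simpa only [ZMod.natCast_zmod_val] using this
  clear_value M
  have hK1 : ∀ s t, t ≠ 0 → ‖K s t‖ ≤ M * g * (t.val.gcd q) := by
    intro s t _
    refine (hKint s t).trans ?_
    rw [mul_assoc]
    gcongr
    refine le_trans ?_ (le_mul_of_one_le_left (by positivity) hg1)
    have hdvd : (-(t.val : ℤ)).gcd (-(s.val * h)) ∣ t.val := by
      simpa only [Int.natAbs_neg, Int.natAbs_natCast] using
        Int.gcd_dvd_natAbs_left (-(t.val : ℤ)) (-(s.val * h))
    exact Nat.cast_le.mpr (Nat.le_of_dvd (Nat.gcd_pos_of_pos_right _ (NeZero.pos q))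
      (Nat.gcd_dvd_gcd_of_dvd_left _ hdvd))
  have hK2 : ∀ s, ‖K s 0‖ ≤ M * g * (s.val.gcd q) := by
    intro s
    refine (hKint s 0).trans ?_
    rw [mul_assoc]
    gcongr
    rw [ZMod.val_zero]
    have h1 : ((-((0 : ℕ) : ℤ)).gcd (-(s.val * h))).gcd q = (s.val * h.natAbs).gcd q := by
      rw [Int.gcd, Int.natAbs_neg, Int.natAbs_neg, Int.natAbs_mul, Int.natAbs_natCast,
        Int.natAbs_natCast, Nat.gcd_zero_left]
    rw [h1, mul_comm s.val]
    have h2 : 0 < h.natAbs.gcd q * s.val.gcd q :=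
      Nat.mul_pos (Nat.gcd_pos_of_pos_right _ (NeZero.pos q))
        (Nat.gcd_pos_of_pos_right _ (NeZero.pos q))
    have h3 := Nat.le_of_dvd h2 (Nat.gcd_mul_left_dvd_mul_gcd q h.natAbs s.val)
    rw [hg, ← Nat.cast_mul]
    exact Nat.cast_le.mpr h3
  have hD0 : D 0 = n := by simp [hD, incompleteSum]
  have hD0' : D' 0 = m := by simp [hD', incompleteSum]
  have hDe : ∀ s, s ≠ 0 → ‖D s‖ ≤ q * e s := fun s hs ↦ norm_incompleteSum_le A n hs
  have hDe' : ∀ s, s ≠ 0 → ‖D' s‖ ≤ q * e s := fun s hs ↦ norm_incompleteSum_le B m hs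
  have hK00 : K 0 0 = q.totient := by
    simp [hK, kloostermanSum, ZMod.card_units_eq_totient]
  have hW : ∑ s ∈ univ.erase (0 : ZMod q), e s * (s.val.gcd q : ℝ) ≤ L :=
    (sum_weight_gcd_le q).trans hL
  have hW0 : ∑ s ∈ univ.erase (0 : ZMod q), e s ≤ L :=
    (sum_le_sum fun s _ ↦ le_mul_of_one_le_right (he0 s) (hgs s)).trans hW
  have hL0 : 0 ≤ L := (sum_nonneg fun s _ ↦ he0 s).trans hW0
  have hcount := sq_mul_card_eq_sum_kloostermanSum hprim (Ico A (A + n)) (Ico B (B + m)) h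
  set N := #{p ∈ Ico A (A + n) ×ˢ Ico B (B + m) | p.1 * p.2 ≡ h [ZMOD (q : ℤ)] ∧
    Int.gcd p.2 q = 1} with hN
  change _ = ∑ s, ∑ t, D s * D' t * K s t at hcount
  have hsplit : ((q : ℂ) ^ 2 * N - q.totient * (n * m)) =
      (∑ t ∈ univ.erase 0, D 0 * D' t * K 0 t) + (∑ s ∈ univ.erase 0, D s * D' 0 * K s 0) +
      ∑ s ∈ univ.erase 0, ∑ t ∈ univ.erase 0, D s * D' t * K s t := by
    rw [hcount, ← add_sum_erase univ _ (mem_univ (0 : ZMod q)),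
      ← add_sum_erase univ (fun t ↦ D 0 * D' t * K 0 t) (mem_univ (0 : ZMod q)),
      sum_congr rfl fun s _ ↦ (add_sum_erase univ (fun t ↦ D s * D' t * K s t)
        (mem_univ (0 : ZMod q))).symm, sum_add_distrib, hD0, hD0', hK00]
    ring
  have hn' : ‖D 0‖ ≤ q := by rw [hD0, Complex.norm_natCast]; exact_mod_cast hn
  have hm' : ‖D' 0‖ ≤ q := by rw [hD0', Complex.norm_natCast]; exact_mod_cast hm
  have hb1 : ‖∑ t ∈ univ.erase 0, D 0 * D' t * K 0 t‖ ≤ q ^ 2 * (M * g * L) := by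
    refine (norm_sum_le_of_le (n := fun t : ZMod q ↦ q ^ 2 * (M * g) * (e t * (t.val.gcd q : ℝ))) _
      fun t ht ↦ ?_).trans ?_
    · have ht := ne_of_mem_erase ht
      rw [norm_mul, norm_mul]
      calc _ ≤ q * (q * e t) * (M * g * (t.val.gcd q)) := by
            have := he0 t
            gcongr
            · exact hDe' t ht
            · exact hK1 0 t ht
        _ = _ := by ring
    · rw [← mul_sum, mul_assoc]
      gcongr
  have hb2 : ‖∑ s ∈ univ.erase 0, D s * D' 0 * K s 0‖ ≤ q ^ 2 * (M * g * L) := by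
    refine (norm_sum_le_of_le (n := fun t : ZMod q ↦ q ^ 2 * (M * g) * (e t * (t.val.gcd q : ℝ))) _
      fun s hs ↦ ?_).trans ?_
    · have hs := ne_of_mem_erase hs
      rw [norm_mul, norm_mul]
      calc _ ≤ (q * e s) * q * (M * g * (s.val.gcd q)) := by
            have := he0 s
            gcongr
            · exact hDe s hs
            · exact hK2 s
        _ = _ := by ring
    · rw [← mul_sum, mul_assoc]
      gcongr
  have hb3 : ‖∑ s ∈ univ.erase 0, ∑ t ∈ univ.erase 0, D s * D' t * K s t‖ ≤
      q ^ 2 * (M * g * L ^ 2) := by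
    refine (norm_sum_le_of_le (n := fun s : ZMod q ↦ ∑ t ∈ univ.erase (0 : ZMod q),
      q ^ 2 * (M * g) * (e s * (e t * (t.val.gcd q : ℝ)))) _
      fun s hs ↦ norm_sum_le_of_le _ fun t ht ↦ ?_).trans ?_
    · have hs := ne_of_mem_erase hs
      have ht := ne_of_mem_erase ht
      rw [norm_mul, norm_mul]
      calc _ ≤ (q * e s) * (q * e t) * (M * g * (t.val.gcd q)) := by
            have := he0 s
            have := he0 t
            gcongr
            · exact hDe s hs
            · exact hDe' t ht
            · exact hK1 s t ht
        _ = _ := by ring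
    · simp_rw [← mul_sum]
      rw [← sum_mul, mul_assoc, sq L]
      have : 0 ≤ ∑ t ∈ univ.erase (0 : ZMod q), e t * (t.val.gcd q : ℝ) :=
        sum_nonneg fun s _ ↦ mul_nonneg (he0 s) (by positivity)
      gcongr
  have hnorm : ‖((q : ℂ) ^ 2 * N - q.totient * (n * m))‖ ≤
      q ^ 2 * (M * g * (2 * L + L ^ 2)) := by
    rw [hsplit]
    refine (norm_add₃_le).trans ?_
    linarith
  have hreal : ((q : ℂ) ^ 2 * N - q.totient * (n * m)) =
      (((q : ℝ) ^ 2 * (N - q.totient / (q : ℝ) ^ 2 * (n * m)) : ℝ) : ℂ) := by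
    push_cast
    have : (q : ℂ) ≠ 0 := by exact_mod_cast hq.ne'
    field_simp
  rw [hreal, Complex.norm_real, Real.norm_eq_abs, abs_mul, abs_of_pos (by positivity)] at hnorm
  exact le_of_mul_le_mul_left hnorm (by positivity)

end DiscreteBox

section RealBox

open Finset MeasureTheory

lemma exists_Ico_of_ordConnected {X : Set ℝ} (hX : X.OrdConnected) {c : ℝ} {q : ℕ}
    (hXc : X ⊆ Set.Ico c (c + q)) :
    ∃ (A : ℤ) (n : ℕ), (∀ a : ℤ, (a : ℝ) ∈ X ↔ a ∈ Ico A (A + n)) ∧ n ≤ q ∧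
      |(n : ℝ) - (volume X).toReal| ≤ 1 := by
  classical
  have hfin : {a : ℤ | (a : ℝ) ∈ X}.Finite := by
    refine (Set.finite_Icc ⌈c⌉ ⌊c + q⌋).subset fun a ha ↦ ?_
    have := hXc ha
    exact ⟨Int.ceil_le.mpr this.1, Int.le_floor.mpr this.2.le⟩
  rcases Set.eq_empty_or_nonempty {a : ℤ | (a : ℝ) ∈ X} with hemp | hne
  · have hno : ∀ a : ℤ, (a : ℝ) ∉ X := fun a ha ↦ by
      have : a ∈ {a : ℤ | (a : ℝ) ∈ X} := ha
      rw [hemp] at this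
      exact this
    refine ⟨0, 0, fun a ↦ by simpa using hno a, Nat.zero_le _, ?_⟩
    rcases X.eq_empty_or_nonempty with rfl | ⟨x, hx⟩
    · simp
    have hsub : X ⊆ Set.Icc (⌊x⌋ : ℝ) (⌊x⌋ + 1) := by
      intro y hy
      constructor
      · by_contra! h
        exact hno ⌊x⌋ (hX.out hy hx ⟨h.le, Int.floor_le x⟩)
      · by_contra! h
        refine hno (⌊x⌋ + 1) (hX.out hx hy ⟨?_, ?_⟩)
        · push_cast; exact (Int.lt_floor_add_one x).le
        · push_cast; exact h.le
    have hv : (volume X).toReal ≤ 1 := by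
      have := ENNReal.toReal_mono (by simp) (measure_mono (μ := volume) hsub)
      rw [Real.volume_Icc] at this
      simpa using this
    rw [Nat.cast_zero, zero_sub, abs_neg, abs_of_nonneg ENNReal.toReal_nonneg]
    exact hv
  · obtain ⟨A, hAmin⟩ := hfin.exists_minimal hne
    obtain ⟨B, hBmax⟩ := hfin.exists_maximal hne
    have hA := hAmin.prop
    have hB := hBmax.prop
    have hlow : ∀ a : ℤ, (a : ℝ) ∈ X → A ≤ a := fun a ha ↦
      (le_total A a).elim id fun h ↦ hAmin.2 ha h
    have hup : ∀ a : ℤ, (a : ℝ) ∈ X → a ≤ B := fun a ha ↦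
      (le_total B a).elim (fun h ↦ hBmax.2 ha h) id
    have hA' : (A : ℝ) ∈ X := hA
    have hB' : (B : ℝ) ∈ X := hB
    have hAB : A ≤ B := hlow B hB
    have hn : (((B + 1 - A).toNat : ℕ) : ℤ) = B + 1 - A := Int.toNat_of_nonneg (by omega)
    have hnr : (((B + 1 - A).toNat : ℕ) : ℝ) = B + 1 - A := by
      rw [← Int.cast_natCast, hn]; push_cast; ring
    refine ⟨A, (B + 1 - A).toNat, fun a ↦ ?_, ?_, ?_⟩
    · rw [mem_Ico, hn]
      constructor
      · intro ha
        exact ⟨hlow a ha, by have := hup a ha; omega⟩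
      · rintro ⟨h1, h2⟩
        exact hX.out hA' hB' ⟨by exact_mod_cast h1, by exact_mod_cast (by omega : a ≤ B)⟩
    · have h1 := (hXc hA').1
      have h2 := (hXc hB').2
      have h3 : (B : ℝ) < A + q := by linarith
      have h4 : B < A + q := by exact_mod_cast h3
      omega
    · have hsub1 : Set.Icc (A : ℝ) B ⊆ X := hX.out hA' hB'
      have hsub2 : X ⊆ Set.Icc ((A : ℝ) - 1) (B + 1) := by
        intro y hy
        constructor
        · by_contra! h
          have : ((A - 1 : ℤ) : ℝ) ∈ X := hX.out hy hA' ⟨by push_cast; exact h.le, by simp⟩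
          have := hlow _ this
          omega
        · by_contra! h
          have : ((B + 1 : ℤ) : ℝ) ∈ X := hX.out hB' hy ⟨by simp, by push_cast; exact h.le⟩
          have := hup _ this
          omega
      have hvfin : volume X ≠ ⊤ := measure_ne_top_of_subset hsub2 (by simp)
      have hv1 := ENNReal.toReal_mono hvfin (measure_mono (μ := volume) hsub1)
      have hv2 := ENNReal.toReal_mono (by simp) (measure_mono (μ := volume) hsub2)
      have hABr : (A : ℝ) ≤ B := by exact_mod_cast hAB
      rw [Real.volume_Icc, ENNReal.toReal_ofReal (by linarith)] at hv1 hv2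
      rw [hnr, abs_le]
      constructor <;> linarith

lemma exists_abs_card_congruence_sub_volume_le {δ : ℝ} (hδ : 0 < δ) :
    ∃ C : ℝ, 0 < C ∧ ∀ (q : ℕ), q ≠ 0 → ∀ (h : ℤ) (X Y : Set ℝ), X.OrdConnected → Y.OrdConnected →
      ∀ c c' : ℝ, X ⊆ Set.Ico c (c + q) → Y ⊆ Set.Ico c' (c' + q) → ∀ P : Finset (ℤ × ℤ),
      (∀ p, p ∈ P ↔ (p.1 : ℝ) ∈ X ∧ (p.2 : ℝ) ∈ Y ∧ p.1 * p.2 ≡ h [ZMOD (q : ℤ)] ∧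
        Int.gcd p.2 q = 1) →
      |(#P : ℝ) - q.totient / (q : ℝ) ^ 2 * ((volume X).toReal * (volume Y).toReal)| ≤
        C * (q : ℝ) ^ ((1 / 2 : ℝ) + δ) * (Int.gcd h q : ℝ) := by
  have hδ3 : 0 < δ / 3 := by positivity
  have hδ6 : 0 < δ / 6 := by positivity
  obtain ⟨C₁, hC₁1, hC₁⟩ := exists_pow_card_primeFactors_le (c := 6) (by norm_num) hδ3
  obtain ⟨C₂, hC₂1, hC₂⟩ := exists_card_divisors_le hδ6
  set C₃ : ℝ := 2 * C₂ * (1 + 1 / (δ / 6)) with hC₃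
  have hC₃1 : 1 ≤ C₃ := by
    have : 0 < 1 / (δ / 6) := by positivity
    rw [hC₃]; nlinarith
  refine ⟨C₁ * (3 * C₃ ^ 2) + 2, by positivity, ?_⟩
  intro q hq0 h X Y hX hY c c' hXc hYc P hP
  have : NeZero q := ⟨hq0⟩
  have hq : (1 : ℝ) ≤ q := by exact_mod_cast Nat.one_le_iff_ne_zero.mpr hq0
  obtain ⟨A, n, hA, hn, hnX⟩ := exists_Ico_of_ordConnected hX hXc
  obtain ⟨B, m, hB, hm, hmY⟩ := exists_Ico_of_ordConnected hY hYc
  have hPeq : P = {p ∈ Ico A (A + n) ×ˢ Ico B (B + m) | p.1 * p.2 ≡ h [ZMOD (q : ℤ)] ∧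
      Int.gcd p.2 q = 1} := by
    ext p
    rw [hP, mem_filter, mem_product, hA, hB, and_assoc]
  set L : ℝ := C₃ * (q : ℝ) ^ (δ / 3) with hL
  have hlog : 1 + Real.log q ≤ (1 + 1 / (δ / 6)) * (q : ℝ) ^ (δ / 6) := by
    have h1 := Real.log_le_rpow_div (x := q) (by linarith) hδ6
    have h2 : 1 ≤ (q : ℝ) ^ (δ / 6) := Real.one_le_rpow hq hδ6.le
    rw [add_mul, one_mul]
    have : (q : ℝ) ^ (δ / 6) / (δ / 6) = 1 / (δ / 6) * (q : ℝ) ^ (δ / 6) := by ring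
    linarith
  have hLbound : 2 * q.divisors.card * (1 + Real.log q) ≤ L := by
    have h0 : 0 ≤ 1 + Real.log q := by linarith [Real.log_nonneg hq]
    calc _ ≤ 2 * (C₂ * (q : ℝ) ^ (δ / 6)) * ((1 + 1 / (δ / 6)) * (q : ℝ) ^ (δ / 6)) := by
          gcongr
          exact hC₂ q hq0
      _ = C₃ * ((q : ℝ) ^ (δ / 6) * (q : ℝ) ^ (δ / 6)) := by rw [hC₃]; ring
      _ = L := by
          rw [← Real.rpow_add (by linarith), hL]
          ring_nf
  have hbox := abs_card_congruence_box_sub_le h A B hn hm hLbound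
  rw [← hPeq] at hbox
  set g : ℝ := (Int.gcd h q : ℝ) with hg
  have hg1 : 1 ≤ g := by
    rw [hg]; exact_mod_cast Int.gcd_pos_of_ne_zero_right _ (by exact_mod_cast hq0)
  have hqδ : 1 ≤ (q : ℝ) ^ (δ / 3) := Real.one_le_rpow hq hδ3.le
  have hL1 : 1 ≤ L := one_le_mul_of_one_le_of_one_le hC₃1 hqδ
  have hE : 6 ^ q.primeFactors.card * √(q : ℝ) * g * (2 * L + L ^ 2) ≤
      C₁ * (3 * C₃ ^ 2) * (q : ℝ) ^ ((1 / 2 : ℝ) + δ) * g := by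
    calc _ ≤ (C₁ * (q : ℝ) ^ (δ / 3)) * (q : ℝ) ^ (1 / 2 : ℝ) * g * (3 * L ^ 2) := by
          rw [Real.sqrt_eq_rpow]
          gcongr
          · exact hC₁ q hq0
          · nlinarith
      _ = C₁ * (3 * C₃ ^ 2) * ((q : ℝ) ^ (1 / 2 : ℝ) *
            ((q : ℝ) ^ (δ / 3) * ((q : ℝ) ^ (δ / 3) * (q : ℝ) ^ (δ / 3)))) * g := by
          rw [hL]; ring
      _ = _ := by
          have h0 : (0 : ℝ) < q := by linarith
          rw [← Real.rpow_add h0, ← Real.rpow_add h0, ← Real.rpow_add h0]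
          ring_nf
  set x := (volume X).toReal
  set y := (volume Y).toReal
  have hx0 : 0 ≤ x := ENNReal.toReal_nonneg
  have hxq : x ≤ q := by
    have := ENNReal.toReal_mono (by simp) (measure_mono (μ := volume) hXc)
    rw [Real.volume_Ico] at this
    simpa using this
  have hnm : |(n : ℝ) * m - x * y| ≤ 2 * q := by
    have h1 : (n : ℝ) * m - x * y = (n - x) * m + x * (m - y) := by ring
    have hmq : (m : ℝ) ≤ q := by exact_mod_cast hm
    rw [h1]
    refine (abs_add_le _ _).trans ?_
    rw [abs_mul, abs_mul, Nat.abs_cast, abs_of_nonneg hx0]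
    have h2 : |(n : ℝ) - x| * m ≤ 1 * q := by gcongr
    have h3 : x * |(m : ℝ) - y| ≤ q * 1 := by gcongr
    linarith
  have htot : (q.totient : ℝ) / (q : ℝ) ^ 2 * (2 * q) ≤ 2 := by
    have h1 : (q.totient : ℝ) ≤ q := by exact_mod_cast q.totient_le
    rw [div_mul_eq_mul_div, div_le_iff₀ (by positivity)]
    nlinarith
  have hmain : |(q.totient : ℝ) / (q : ℝ) ^ 2 * (n * m) -
      q.totient / (q : ℝ) ^ 2 * (x * y)| ≤ 2 := by
    rw [← mul_sub, abs_mul, abs_of_nonneg (by positivity)]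
    exact (mul_le_mul_of_nonneg_left hnm (by positivity)).trans htot
  have htri := abs_sub_le (#P : ℝ) (q.totient / (q : ℝ) ^ 2 * (n * m))
    (q.totient / (q : ℝ) ^ 2 * (x * y))
  have h2 : (2 : ℝ) ≤ 2 * (q : ℝ) ^ ((1 / 2 : ℝ) + δ) * g := by
    have : 1 ≤ (q : ℝ) ^ ((1 / 2 : ℝ) + δ) := Real.one_le_rpow hq (by positivity)
    nlinarith
  linarith

end RealBox

section WeightedSum

open Finset MeasureTheory

lemma abs_sum_sub_integral_le_of_oscillation {X Y : Set ℝ}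
    (hXfin : volume X ≠ ⊤) (hYfin : volume Y ≠ ⊤) {f : ℝ × ℝ → ℝ}
    (hf : IntegrableOn f (X ×ˢ Y)) {κ η M E : ℝ} (hκ : 0 ≤ κ) (hη : 0 ≤ η) (hM : 0 ≤ M)
    (hosc : ∀ p ∈ X ×ˢ Y, ∀ p' ∈ X ×ˢ Y, |f p - f p'| ≤ η) (hfM : ∀ p ∈ X ×ˢ Y, |f p| ≤ M)
    {P : Finset (ℤ × ℤ)} (hP : ∀ p ∈ P, ((p.1 : ℝ), (p.2 : ℝ)) ∈ X ×ˢ Y)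
    (hE : |(#P : ℝ) - κ * ((volume X).toReal * (volume Y).toReal)| ≤ E) :
    |∑ p ∈ P, f ((p.1 : ℝ), (p.2 : ℝ)) - κ * ∫ p in X ×ˢ Y, f p| ≤
      2 * η * κ * ((volume X).toReal * (volume Y).toReal) + (η + M) * E := by
  have hE0 : 0 ≤ E := (abs_nonneg _).trans hE
  have hv : volume.real (X ×ˢ Y) = (volume X).toReal * (volume Y).toReal := by
    rw [Measure.real, Measure.volume_eq_prod, Measure.prod_prod, ENNReal.toReal_mul]
  have hvfin : volume (X ×ˢ Y) ≠ ⊤ := by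
    rw [Measure.volume_eq_prod, Measure.prod_prod]
    exact ENNReal.mul_ne_top hXfin hYfin
  have hv0 : 0 ≤ volume.real (X ×ˢ Y) := measureReal_nonneg
  rw [← hv] at hE ⊢
  set v := volume.real (X ×ˢ Y)
  rcases (X ×ˢ Y).eq_empty_or_nonempty with hemp | ⟨p₀, hp₀⟩
  · have hPe : P = ∅ := Finset.eq_empty_of_forall_notMem fun p hp ↦ by
      have := hP p hp
      rw [hemp] at this
      exact this
    rw [hPe, hemp]
    simp only [Finset.sum_empty, Measure.restrict_empty, integral_zero_measure, mul_zero, sub_zero,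
      abs_zero]
    positivity
  have hint : ∫ p in X ×ˢ Y, (f p - f p₀) = (∫ p in X ×ˢ Y, f p) - v * f p₀ := by
    rw [integral_sub hf (integrableOn_const hvfin), setIntegral_const, smul_eq_mul]
  have hint_le : |∫ p in X ×ˢ Y, (f p - f p₀)| ≤ η * v :=
    norm_setIntegral_le_of_norm_le_const (f := fun p ↦ f p - f p₀) hvfin.lt_top
      fun p hp ↦ hosc p hp p₀ hp₀
  have hsum : ∑ p ∈ P, (f ((p.1 : ℝ), (p.2 : ℝ)) - f p₀) =
      ∑ p ∈ P, f ((p.1 : ℝ), (p.2 : ℝ)) - #P * f p₀ := by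
    rw [sum_sub_distrib, sum_const, nsmul_eq_mul]
  have hsum_le : |∑ p ∈ P, (f ((p.1 : ℝ), (p.2 : ℝ)) - f p₀)| ≤ #P * η := by
    refine (abs_sum_le_sum_abs _ _).trans ?_
    rw [← nsmul_eq_mul]
    exact sum_le_card_nsmul _ _ _ fun p hp ↦ hosc _ (hP p hp) p₀ hp₀
  have hcard : (#P : ℝ) ≤ κ * v + E := by linarith [(abs_le.mp hE).2]
  have hdecomp : ∑ p ∈ P, f ((p.1 : ℝ), (p.2 : ℝ)) - κ * ∫ p in X ×ˢ Y, f p =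
      ∑ p ∈ P, (f ((p.1 : ℝ), (p.2 : ℝ)) - f p₀) - κ * (∫ p in X ×ˢ Y, (f p - f p₀)) +
        (#P - κ * v) * f p₀ := by
    rw [hint, hsum]; ring
  rw [hdecomp]
  calc _ ≤ |∑ p ∈ P, (f ((p.1 : ℝ), (p.2 : ℝ)) - f p₀)| +
        κ * |∫ p in X ×ˢ Y, (f p - f p₀)| + |#P - κ * v| * |f p₀| := by
        refine (abs_add_le _ _).trans ?_
        rw [abs_mul]
        gcongr
        refine (abs_sub _ _).trans ?_
        rw [abs_mul, abs_of_nonneg hκ]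
    _ ≤ (κ * v + E) * η + κ * (η * v) + E * M := by
        gcongr
        · exact hsum_le.trans (by gcongr)
        · exact hfM p₀ hp₀
    _ = _ := by ring

lemma exists_finset_floor_div_mem {I : Set ℝ} (hI : I.OrdConnected) (hIb : Bornology.IsBounded I)
    {s : ℝ} (hs : 0 < s) :
    ∃ S : Finset ℤ, (∀ x ∈ I, ⌊x / s⌋ ∈ S) ∧ (#S : ℝ) ≤ (volume I).toReal / s + 2 := by
  rcases I.eq_empty_or_nonempty with rfl | hne
  · exact ⟨∅, by simp, by simp⟩
  have hbb := hIb.bddBelow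
  have hba := hIb.bddAbove
  have hle : sInf I ≤ sSup I := csInf_le_csSup hne hbb hba
  refine ⟨Icc ⌊sInf I / s⌋ ⌊sSup I / s⌋, fun x hx ↦ mem_Icc.mpr ⟨?_, ?_⟩, ?_⟩
  · gcongr; exact csInf_le hbb hx
  · gcongr; exact le_csSup hba hx
  have hvol : sSup I - sInf I ≤ (volume I).toReal := by
    have h1 := ENNReal.toReal_mono hIb.measure_lt_top.ne
      (measure_mono (μ := volume)
        (IsConnected.Ioo_csInf_csSup_subset ⟨hne, hI.isPreconnected⟩ hbb hba))
    rwa [Real.volume_Ioo, ENNReal.toReal_ofReal (by linarith)] at h1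
  have hfl : ⌊sInf I / s⌋ ≤ ⌊sSup I / s⌋ := by gcongr
  have hcard : ((#(Icc ⌊sInf I / s⌋ ⌊sSup I / s⌋) : ℕ) : ℝ) =
      ⌊sSup I / s⌋ + 1 - ⌊sInf I / s⌋ := by
    have h1 := Int.card_Icc_of_le ⌊sInf I / s⌋ ⌊sSup I / s⌋ (by omega)
    exact_mod_cast h1
  rw [hcard]
  have h1 := Int.floor_le (sSup I / s)
  have h2 := Int.lt_floor_add_one (sInf I / s)
  have h3 : (sSup I - sInf I) / s ≤ (volume I).toReal / s := by gcongr
  rw [sub_div] at h3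
  linarith

/-- The cell of `I` with index `k`, in the subdivision of the real line with step `s`. -/
def gridCell (s : ℝ) (I : Set ℝ) (k : ℤ) : Set ℝ := I ∩ Set.Ico (k * s) (k * s + s)

lemma mem_gridCell_iff {s : ℝ} (hs : 0 < s) {I : Set ℝ} {k : ℤ} {x : ℝ} :
    x ∈ gridCell s I k ↔ x ∈ I ∧ ⌊x / s⌋ = k := by
  rw [gridCell, Set.mem_inter_iff, Set.mem_Ico, Int.floor_eq_iff, le_div_iff₀ hs, div_lt_iff₀ hs,
    add_mul, one_mul]

lemma pairwiseDisjoint_gridCell {s : ℝ} (hs : 0 < s) (I : Set ℝ) (S : Set ℤ) :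
    S.PairwiseDisjoint (gridCell s I) := fun _ _ _ _ hkl ↦
  Set.disjoint_left.mpr fun _ hx hx' ↦
    hkl (((mem_gridCell_iff hs).mp hx).2.symm.trans ((mem_gridCell_iff hs).mp hx').2)

lemma biUnion_gridCell {s : ℝ} (hs : 0 < s) {I : Set ℝ} {S : Finset ℤ}
    (hS : ∀ x ∈ I, ⌊x / s⌋ ∈ S) : ⋃ k ∈ S, gridCell s I k = I := by
  ext x
  simp only [Set.mem_iUnion, mem_gridCell_iff hs, exists_prop]
  exact ⟨fun ⟨_, _, h, _⟩ ↦ h, fun h ↦ ⟨_, hS x h, h, rfl⟩⟩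

lemma measurableSet_gridCell (s : ℝ) {I : Set ℝ} (hI : MeasurableSet I) (k : ℤ) :
    MeasurableSet (gridCell s I k) := hI.inter measurableSet_Ico

lemma sum_volume_gridCell {s : ℝ} (hs : 0 < s) {I : Set ℝ} (hI : MeasurableSet I)
    (hfin : volume I ≠ ⊤) {S : Finset ℤ} (hS : ∀ x ∈ I, ⌊x / s⌋ ∈ S) :
    ∑ k ∈ S, (volume (gridCell s I k)).toReal = (volume I).toReal := by
  have hcell : ∀ k ∈ S, volume (gridCell s I k) ≠ ⊤ := fun k _ ↦
    measure_ne_top_of_subset Set.inter_subset_left hfin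
  rw [← ENNReal.toReal_sum hcell,
    ← measure_biUnion_finset (pairwiseDisjoint_gridCell hs I S)
      fun k _ ↦ measurableSet_gridCell s hI k, biUnion_gridCell hs hS]

lemma setIntegral_prod_eq_sum_gridCell {s : ℝ} (hs : 0 < s) {I J : Set ℝ} (hI : MeasurableSet I)
    (hJ : MeasurableSet J) {S S' : Finset ℤ} (hS : ∀ x ∈ I, ⌊x / s⌋ ∈ S)
    (hS' : ∀ x ∈ J, ⌊x / s⌋ ∈ S') {f : ℝ × ℝ → ℝ} (hf : IntegrableOn f (I ×ˢ J)) :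
    ∫ p in I ×ˢ J, f p =
      ∑ k ∈ S ×ˢ S', ∫ p in gridCell s I k.1 ×ˢ gridCell s J k.2, f p := by
  rw [← integral_biUnion_finset]
  · congr 2
    ext p
    simp only [Set.mem_iUnion, Set.mem_prod, mem_gridCell_iff hs, exists_prop, mem_product]
    exact ⟨fun ⟨h, h'⟩ ↦ ⟨(⌊p.1 / s⌋, ⌊p.2 / s⌋), ⟨hS _ h, hS' _ h'⟩, ⟨h, rfl⟩, h', rfl⟩,
      fun ⟨_, _, h, h'⟩ ↦ ⟨h.1, h'.1⟩⟩
  · exact fun k _ ↦ (measurableSet_gridCell s hI _).prod (measurableSet_gridCell s hJ _)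
  · intro k _ l _ hkl
    refine Set.disjoint_left.mpr fun p hp hp' ↦ hkl (Prod.ext ?_ ?_)
    · exact ((mem_gridCell_iff hs).mp hp.1).2.symm.trans ((mem_gridCell_iff hs).mp hp'.1).2
    · exact ((mem_gridCell_iff hs).mp hp.2).2.symm.trans ((mem_gridCell_iff hs).mp hp'.2).2
  · exact fun k _ ↦ hf.mono_set (Set.prod_mono Set.inter_subset_left Set.inter_subset_left)

lemma exists_finset_tsum_tsum_ite_eq {I J : Set ℝ} (hI : Bornology.IsBounded I)
    (hJ : Bornology.IsBounded J) (R : ℤ → ℤ → Prop) (f : ℝ × ℝ → ℝ)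
    [∀ a b : ℤ, Decidable ((a : ℝ) ∈ I ∧ (b : ℝ) ∈ J ∧ R a b)] :
    ∃ P : Finset (ℤ × ℤ), (∀ p, p ∈ P ↔ (p.1 : ℝ) ∈ I ∧ (p.2 : ℝ) ∈ J ∧ R p.1 p.2) ∧
      ∑' (a : ℤ) (b : ℤ), (if (a : ℝ) ∈ I ∧ (b : ℝ) ∈ J ∧ R a b then f ((a : ℝ), (b : ℝ)) else 0) =
        ∑ p ∈ P, f ((p.1 : ℝ), (p.2 : ℝ)) := by
  have key : ∀ K : Set ℝ, Bornology.IsBounded K → ∃ A : Finset ℤ, ∀ a : ℤ, (a : ℝ) ∈ K → a ∈ A := by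
    intro K hK
    obtain ⟨l, hl⟩ := hK.bddBelow
    obtain ⟨u, hu⟩ := hK.bddAbove
    exact ⟨Icc ⌈l⌉ ⌊u⌋, fun a ha ↦
      mem_Icc.mpr ⟨Int.ceil_le.mpr (hl ha), Int.le_floor.mpr (hu ha)⟩⟩
  obtain ⟨A, hA⟩ := key I hI
  obtain ⟨B, hB⟩ := key J hJ
  refine ⟨{p ∈ A ×ˢ B | (p.1 : ℝ) ∈ I ∧ (p.2 : ℝ) ∈ J ∧ R p.1 p.2}, fun p ↦ ?_, ?_⟩
  · rw [mem_filter, mem_product]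
    exact ⟨fun h ↦ h.2, fun h ↦ ⟨⟨hA _ h.1, hB _ h.2.1⟩, h⟩⟩
  · rw [sum_filter, sum_product, tsum_eq_sum (s := A)]
    · refine sum_congr rfl fun a _ ↦ tsum_eq_sum (s := B) fun b hb ↦ if_neg fun h ↦ hb (hB b h.2.1)
    · intro a ha
      simp only [show ¬ (a : ℝ) ∈ I from fun h ↦ ha (hA a h), false_and, if_false, tsum_zero]

lemma abs_sub_le_of_norm_fderivWithin_le {I J : Set ℝ} (hI : I.OrdConnected) (hJ : J.OrdConnected)
    {f : ℝ × ℝ → ℝ} (hf : ContDiffOn ℝ 1 f (I ×ˢ J)) {D : ℝ} (hD0 : 0 ≤ D)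
    (hD : ∀ p ∈ I ×ˢ J, ‖fderivWithin ℝ f (I ×ˢ J) p‖ ≤ D) {s : ℝ} {k l : ℤ} {p p' : ℝ × ℝ}
    (hp : p ∈ gridCell s I k ×ˢ gridCell s J l) (hp' : p' ∈ gridCell s I k ×ˢ gridCell s J l) :
    |f p - f p'| ≤ D * s := by
  have h1 := (hI.convex.prod hJ.convex).norm_image_sub_le_of_norm_fderivWithin_le
    (hf.differentiableOn one_ne_zero) hD ⟨hp'.1.1, hp'.2.1⟩ ⟨hp.1.1, hp.2.1⟩
  refine h1.trans (mul_le_mul_of_nonneg_left ?_ hD0)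
  have h2 := hp.1.2
  have h3 := hp.2.2
  have h4 := hp'.1.2
  have h5 := hp'.2.2
  rw [Set.mem_Ico] at h2 h3 h4 h5
  rw [Prod.norm_def, max_le_iff, Real.norm_eq_abs, Real.norm_eq_abs, abs_le, abs_le]
  simp only [Prod.fst_sub, Prod.snd_sub]
  refine ⟨⟨?_, ?_⟩, ?_, ?_⟩ <;> linarith

lemma abs_sum_sub_integral_le_of_grid {I J : Set ℝ} (hI : I.OrdConnected) (hJ : J.OrdConnected)
    (hIb : Bornology.IsBounded I) (hJb : Bornology.IsBounded J) {f : ℝ × ℝ → ℝ}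
    (hf : ContDiffOn ℝ 1 f (I ×ˢ J)) {M D : ℝ} (hM0 : 0 ≤ M) (hD0 : 0 ≤ D)
    (hM : ∀ p ∈ I ×ˢ J, |f p| ≤ M) (hD : ∀ p ∈ I ×ˢ J, ‖fderivWithin ℝ f (I ×ˢ J) p‖ ≤ D)
    {s κ E : ℝ} (hs : 0 < s) (hκ : 0 ≤ κ) {R : ℤ → ℤ → Prop} {P : Finset (ℤ × ℤ)}
    (hP : ∀ p, p ∈ P ↔ (p.1 : ℝ) ∈ I ∧ (p.2 : ℝ) ∈ J ∧ R p.1 p.2)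
    (hE : ∀ (X Y : Set ℝ), X.OrdConnected → Y.OrdConnected → ∀ c c' : ℝ,
      X ⊆ Set.Ico c (c + s) → Y ⊆ Set.Ico c' (c' + s) → ∀ Q : Finset (ℤ × ℤ),
      (∀ p, p ∈ Q ↔ (p.1 : ℝ) ∈ X ∧ (p.2 : ℝ) ∈ Y ∧ R p.1 p.2) →
      |(#Q : ℝ) - κ * ((volume X).toReal * (volume Y).toReal)| ≤ E) :
    |∑ p ∈ P, f ((p.1 : ℝ), (p.2 : ℝ)) - κ * ∫ p in I ×ˢ J, f p| ≤
      2 * (D * s) * κ * ((volume I).toReal * (volume J).toReal) +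
        ((volume I).toReal / s + 2) * ((volume J).toReal / s + 2) * ((D * s + M) * E) := by
  have hIm := hI.measurableSet
  have hJm := hJ.measurableSet
  have hIfin : volume I ≠ ⊤ := hIb.measure_lt_top.ne
  have hJfin : volume J ≠ ⊤ := hJb.measure_lt_top.ne
  have hE0 : 0 ≤ E := (abs_nonneg _).trans <| hE ∅ ∅ Set.ordConnected_empty Set.ordConnected_empty
    0 0 (Set.empty_subset _) (Set.empty_subset _) ∅ (by simp)
  obtain ⟨S, hS, hScard⟩ := exists_finset_floor_div_mem hI hIb hs
  obtain ⟨S', hS', hS'card⟩ := exists_finset_floor_div_mem hJ hJb hs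
  have hfint : IntegrableOn f (I ×ˢ J) :=
    ⟨hf.continuousOn.aestronglyMeasurable (hIm.prod hJm), .restrict_of_bounded (C := M)
      (hIb.prod hJb).measure_lt_top (ae_restrict_of_forall_mem (hIm.prod hJm) hM)⟩
  have hmaps : ∀ p ∈ P, (⌊(p.1 : ℝ) / s⌋, ⌊(p.2 : ℝ) / s⌋) ∈ S ×ˢ S' := fun p hp ↦
    mem_product.mpr ⟨hS _ ((hP p).mp hp).1, hS' _ ((hP p).mp hp).2.1⟩
  rw [setIntegral_prod_eq_sum_gridCell hs hIm hJm hS hS' hfint, ← sum_fiberwise_of_maps_to hmaps,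
    mul_sum, ← sum_sub_distrib]
  have hcell : ∀ k ∈ S ×ˢ S',
      |∑ p ∈ P with (⌊(p.1 : ℝ) / s⌋, ⌊(p.2 : ℝ) / s⌋) = k, f ((p.1 : ℝ), (p.2 : ℝ)) -
        κ * ∫ p in gridCell s I k.1 ×ˢ gridCell s J k.2, f p| ≤
      2 * (D * s) * κ * ((volume (gridCell s I k.1)).toReal * (volume (gridCell s J k.2)).toReal) +
        (D * s + M) * E := by
    intro k _
    have hmem : ∀ p, p ∈ {p ∈ P | (⌊(p.1 : ℝ) / s⌋, ⌊(p.2 : ℝ) / s⌋) = k} ↔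
        (p.1 : ℝ) ∈ gridCell s I k.1 ∧ (p.2 : ℝ) ∈ gridCell s J k.2 ∧ R p.1 p.2 := by
      intro p
      rw [mem_filter, hP, mem_gridCell_iff hs, mem_gridCell_iff hs, Prod.ext_iff]
      tauto
    refine abs_sum_sub_integral_le_of_oscillation
      (measure_ne_top_of_subset Set.inter_subset_left hIfin)
      (measure_ne_top_of_subset Set.inter_subset_left hJfin)
      (hfint.mono_set (Set.prod_mono Set.inter_subset_left Set.inter_subset_left)) hκ
      (by positivity) hM0
      (fun p hp p' hp' ↦ abs_sub_le_of_norm_fderivWithin_le hI hJ hf hD0 hD hp hp')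
      (fun p hp ↦ hM p ⟨hp.1.1, hp.2.1⟩) (fun p hp ↦ ⟨((hmem p).mp hp).1, ((hmem p).mp hp).2.1⟩) ?_
    exact hE _ _ (hI.inter Set.ordConnected_Ico) (hJ.inter Set.ordConnected_Ico) _ _
      Set.inter_subset_right Set.inter_subset_right _ hmem
  refine (abs_sum_le_sum_abs _ _).trans ((sum_le_sum hcell).trans ?_)
  rw [sum_add_distrib, ← mul_sum, sum_const, nsmul_eq_mul, card_product, Nat.cast_mul,
    sum_product' S S'
      (fun k l ↦ (volume (gridCell s I k)).toReal * (volume (gridCell s J l)).toReal),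
    ← sum_mul_sum, sum_volume_gridCell hs hIm hIfin hS, sum_volume_gridCell hs hJm hJfin hS']
  gcongr

end WeightedSum

open MeasureTheory Real
open scoped Classical

/-- Proposition A2 / Proposition 3.3: equidistribution of solutions of
`ab ≡ h (mod q)` with `C¹` weights.  Here `I` and `J` are (bounded) intervals, `Mf` is
a bound for `|f|` on `I × J` and `MDf` a bound for the derivative of `f` on `I × J`. -/
theorem weighted_congruence_equidistribution (δ : ℝ) (hδ : 0 < δ) :
    ∃ C > (0 : ℝ), ∀ (q : ℕ), 1 ≤ q → ∀ (h : ℤ) (I J : Set ℝ),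
      I.OrdConnected → J.OrdConnected →
      Bornology.IsBounded I → Bornology.IsBounded J →
      ∀ f : ℝ × ℝ → ℝ, ContDiffOn ℝ 1 f (I ×ˢ J) →
      ∀ T : ℕ, 1 < T → ∀ Mf MDf : ℝ, 0 ≤ Mf → 0 ≤ MDf →
      (∀ p ∈ I ×ˢ J, |f p| ≤ Mf) →
      (∀ p ∈ I ×ˢ J, ‖fderivWithin ℝ f (I ×ˢ J) p‖ ≤ MDf) →
      |(∑' (a : ℤ) (b : ℤ),
            if (a : ℝ) ∈ I ∧ (b : ℝ) ∈ J ∧ a * b ≡ h [ZMOD (q : ℤ)] ∧ Int.gcd b q = 1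
            then f ((a : ℝ), (b : ℝ)) else 0) -
          (Nat.totient q : ℝ) / (q : ℝ) ^ 2 * ∫ p in I ×ˢ J, f p| ≤
        C * ((1 + (volume I).toReal / q) * (1 + (volume J).toReal / q) * (T : ℝ) ^ 2 *
              Mf * (q : ℝ) ^ ((1 / 2 : ℝ) + δ) * (Int.gcd h q : ℝ) +
            (1 + (volume I).toReal / q) * (1 + (volume J).toReal / q) * (T : ℝ) *
              MDf * (q : ℝ) ^ ((3 / 2 : ℝ) + δ) * (Int.gcd h q : ℝ) +
            (volume I).toReal * (volume J).toReal * MDf / T) := by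
  obtain ⟨C, hC0, hC⟩ := exists_abs_card_congruence_sub_volume_le hδ
  refine ⟨C + 2, by positivity, ?_⟩
  intro q hq1 h I J hI hJ hIb hJb f hf T hT M D hM0 hD0 hM hD
  obtain ⟨P, hP, hsum⟩ := exists_finset_tsum_tsum_ite_eq hIb hJb
    (fun a b ↦ a * b ≡ h [ZMOD (q : ℤ)] ∧ Int.gcd b q = 1) f
  rw [hsum]
  have hq : (1 : ℝ) ≤ q := by exact_mod_cast hq1
  have hT2 : (2 : ℝ) ≤ T := by exact_mod_cast hT
  have hT0 : (0 : ℝ) < T := by linarith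
  have hq0 : (0 : ℝ) < q := by linarith
  have hsq : (q : ℝ) / T ≤ q := div_le_self hq0.le (by linarith)
  set E : ℝ := C * (q : ℝ) ^ ((1 / 2 : ℝ) + δ) * (Int.gcd h q : ℝ) with hE
  have hgrid := abs_sum_sub_integral_le_of_grid
    (R := fun a b ↦ a * b ≡ h [ZMOD (q : ℤ)] ∧ Int.gcd b q = 1) hI hJ hIb hJb hf hM0 hD0 hM hD
    (s := q / T) (κ := q.totient / (q : ℝ) ^ 2) (E := E) (by positivity) (by positivity) hP
    (fun X Y hX hY c c' hXc hYc Q hQ ↦ hC q (by omega) h X Y hX hY c c'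
      (hXc.trans (Set.Ico_subset_Ico_right (by linarith)))
      (hYc.trans (Set.Ico_subset_Ico_right (by linarith))) Q hQ)
  refine hgrid.trans ?_
  set x := (volume I).toReal
  set y := (volume J).toReal
  set g : ℝ := (Int.gcd h q : ℝ)
  have hx : 0 ≤ x := ENNReal.toReal_nonneg
  have hy : 0 ≤ y := ENNReal.toReal_nonneg
  have hcells : ∀ z : ℝ, z / (q / T) + 2 ≤ T * (1 + z / q) := fun z ↦ by
    have : z / (q / T) = T * (z / q) := by field_simp
    rw [this]; linarith
  have hmain : 2 * (D * (q / T)) * (q.totient / (q : ℝ) ^ 2) * (x * y) ≤ 2 * (x * y * D / T) := by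
    have htot : (q.totient : ℝ) ≤ q := by exact_mod_cast q.totient_le
    have : 2 * (D * (q / T)) * (q.totient / (q : ℝ) ^ 2) * (x * y) =
        2 * (x * y * D / T) * (q.totient / q) := by field_simp
    rw [this]
    exact mul_le_of_le_one_right (by positivity) ((div_le_one hq0).mpr htot)
  have hpow : (q : ℝ) ^ ((3 / 2 : ℝ) + δ) = q * (q : ℝ) ^ ((1 / 2 : ℝ) + δ) := by
    rw [← Real.rpow_one_add' hq0.le (by positivity)]
    ring_nf
  have herr : (x / (q / T) + 2) * (y / (q / T) + 2) * ((D * (q / T) + M) * E) ≤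
      C * ((1 + x / q) * (1 + y / q) * (T : ℝ) ^ 2 * M * (q : ℝ) ^ ((1 / 2 : ℝ) + δ) * g +
        (1 + x / q) * (1 + y / q) * T * D * (q : ℝ) ^ ((3 / 2 : ℝ) + δ) * g) := by
    calc _ ≤ (T * (1 + x / q)) * (T * (1 + y / q)) * ((D * (q / T) + M) * E) := by
          gcongr
          · exact hcells x
          · exact hcells y
      _ = _ := by rw [hpow, hE]; field_simp; ring
  have h1 : 0 ≤ (1 + x / q) * (1 + y / q) * (T : ℝ) ^ 2 * M * (q : ℝ) ^ ((1 / 2 : ℝ) + δ) * g +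
      (1 + x / q) * (1 + y / q) * T * D * (q : ℝ) ^ ((3 / 2 : ℝ) + δ) * g := by positivity
  have h2 : 0 ≤ C * (x * y * D / T) := by positivity
  linarith
end

section
/- There are constants c > 0 and q₀ such that for every integer q ≥ q₀ and all integers a, b with 1 ≤ a, b ≤ q and gcd(a,b,q) = 1, one has #𝒩_{a,b,q} ≥ c·φ(q)/ln q; in particular #𝒩_{a,b,q} ≥ c′·q/(ln q · ln ln q) for an absolute constant c′ > 0. -/
/-- `𝒩_{a,b,q} = {(A,B) : 1 ≤ A,B ≤ 2q, gcd(A,B) = 1, q ∣ Ab - Ba}`. -/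
def NNset (a b q : ℕ) : Finset (ℕ × ℕ) :=
  (Finset.Icc 1 (2 * q) ×ˢ Finset.Icc 1 (2 * q)).filter fun p =>
    Nat.gcd p.1 p.2 = 1 ∧ (q : ℤ) ∣ ((p.1 : ℤ) * (b : ℤ) - (p.2 : ℤ) * (a : ℤ))

section NNsetBound

open Finset

theorem exists_modEq_forall_coprime {Q g u : ℕ} (hg : g ≠ 0)
    (h : ∀ r, r.Prime → r ∣ g → r ∣ Q → ¬ r ∣ u) :
    ∃ v, v ≡ u [MOD Q] ∧ ∀ k, Nat.Coprime g k → Nat.Coprime (v + Q * k) g := by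
  have hco : Nat.Coprime Q (∏ r ∈ g.primeFactors with ¬ r ∣ Q, r) := by
    refine Nat.Coprime.prod_right fun r hr => ?_
    obtain ⟨hr, hrQ⟩ := mem_filter.1 hr
    exact ((Nat.Prime.coprime_iff_not_dvd (Nat.prime_of_mem_primeFactors hr)).2 hrQ).symm
  obtain ⟨v, hvQ, hv0⟩ := Nat.chineseRemainder hco u 0
  refine ⟨v, hvQ, fun k hk => Nat.Coprime.symm ?_⟩
  refine Nat.coprime_of_dvd fun r hr hrg hrv => ?_
  by_cases hrQ : r ∣ Q
  · have hrv' : r ∣ v := (Nat.dvd_add_left (hrQ.mul_right k)).1 hrv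
    exact h r hr hrg hrQ ((hvQ.dvd_iff hrQ).1 hrv')
  · have hrm : r ∣ ∏ r ∈ g.primeFactors with ¬ r ∣ Q, r :=
      dvd_prod_of_mem _ (mem_filter.2 ⟨Nat.mem_primeFactors.2 ⟨hr, hrg, hg⟩, hrQ⟩)
    have hrv' : r ∣ v := (hv0.dvd_iff hrm).2 (dvd_zero r)
    have hrk : r ∣ k := (hr.dvd_mul.1 ((Nat.dvd_add_right hrv').1 hrv)).resolve_left hrQ
    exact Nat.not_coprime_of_dvd_of_dvd hr.one_lt hrg hrk hk

theorem exists_modEq_mem_Icc_not_dvd {q p : ℕ} (hq : q ≠ 0) (hp : ¬ p ∣ q) (x : ℕ) :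
    ∃ B ∈ Icc 1 (2 * q), B ≡ x [MOD q] ∧ ¬ p ∣ B := by
  obtain ⟨r, hr1, hrq, hrx⟩ : ∃ r, 1 ≤ r ∧ r ≤ q ∧ r ≡ x [MOD q] := by
    rcases Nat.eq_zero_or_pos (x % q) with h | h
    · exact ⟨q, by lia, le_rfl, by simp [Nat.ModEq, h]⟩
    · exact ⟨x % q, h, (Nat.mod_lt _ (by lia)).le, Nat.mod_modEq x q⟩
  by_cases hpr : p ∣ r
  · refine ⟨r + q, mem_Icc.2 ⟨by lia, by lia⟩, by simpa [Nat.ModEq] using hrx, fun h => hp ?_⟩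
    exact (Nat.dvd_add_right hpr).1 h
  · exact ⟨r, mem_Icc.2 ⟨hr1, by lia⟩, hrx, hpr⟩

theorem exists_modEq_mem_Icc_coprime {q p g : ℕ} (hq : q ≠ 0) (hgq : g ∣ q) (hp : p.Prime)
    (hpg : p ∣ q → p ∣ g) {x : ℕ} (hx : Nat.Coprime x g) :
    ∃ B ∈ Icc 1 (2 * q), B ≡ x [MOD q] ∧ Nat.Coprime (g * p) B := by
  have key : ∀ B, B ≡ x [MOD q] → Nat.Coprime g B := fun B hB => by
    rw [Nat.coprime_iff_gcd_eq_one, Nat.gcd_comm, (hB.of_dvd hgq).gcd_eq]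
    exact hx
  by_cases h : p ∣ q
  · obtain ⟨B, hB, hBx, -⟩ := exists_modEq_mem_Icc_not_dvd hq
      (fun h : q + 1 ∣ q => absurd (Nat.le_of_dvd (by lia) h) (by lia)) x
    exact ⟨B, hB, hBx, (key B hBx).mul_left ((key B hBx).coprime_dvd_left (hpg h))⟩
  · obtain ⟨B, hB, hBx, hpB⟩ := exists_modEq_mem_Icc_not_dvd hq h x
    exact ⟨B, hB, hBx, (key B hBx).mul_left ((Nat.Prime.coprime_iff_not_dvd hp).2 hpB)⟩

theorem sum_log_div_primesLE_le (n : ℕ) :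
    ∑ p ∈ n.primesLE, Real.log p / p ≤ 2 * Real.log n := by
  rcases Nat.eq_zero_or_pos n with rfl | hn
  · simp
  have hdvd : ∏ p ∈ n.primesLE, p ^ (n / p) ∣ n.factorial := by
    refine Finset.prod_dvd_of_isRelPrime (fun p hp r hr hpr => ?_) fun p hp => ?_
    · rw [Function.onFun, ← Nat.coprime_iff_isRelPrime]
      exact Nat.Coprime.pow _ _ ((Nat.coprime_primes (Nat.prime_of_mem_primesLE hp)
        (Nat.prime_of_mem_primesLE hr)).2 hpr)
    · rw [(Nat.prime_of_mem_primesLE hp).pow_dvd_factorial_iff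
        (show Nat.log p n < Nat.log p n + 2 by lia)]
      simpa using single_le_sum (f := fun i => n / p ^ i) (fun i _ => Nat.zero_le _)
        (show 1 ∈ Ico 1 (Nat.log p n + 2) by simp)
  have hle : ∏ p ∈ n.primesLE, (p : ℝ) ^ (n / p) ≤ (n : ℝ) ^ n := by
    exact_mod_cast (Nat.le_of_dvd n.factorial_pos hdvd).trans (Nat.factorial_le_pow n)
  have hpos : ∀ p ∈ n.primesLE, (0 : ℝ) < p := fun p hp => by
    exact_mod_cast (Nat.prime_of_mem_primesLE hp).pos
  have hlog := Real.log_le_log (prod_pos fun p hp => pow_pos (hpos p hp) _) hle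
  rw [Real.log_prod (fun p hp => (pow_pos (hpos p hp) _).ne'), Real.log_pow] at hlog
  have hn' : (0 : ℝ) < n := by exact_mod_cast hn
  refine le_of_mul_le_mul_left ?_ hn'
  calc (n : ℝ) * ∑ p ∈ n.primesLE, Real.log p / p
      ≤ 2 * ∑ p ∈ n.primesLE, Real.log ((p : ℝ) ^ (n / p)) := by
        rw [mul_sum, mul_sum]
        refine sum_le_sum fun p hp => ?_
        have hp0 := hpos p hp
        have hp1 : 1 ≤ n / p := Nat.div_pos (Nat.le_of_mem_primesLE hp)
          (Nat.prime_of_mem_primesLE hp).pos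
        have hlt : n ≤ p * (2 * (n / p)) := by
          have := Nat.lt_mul_div_succ n (Nat.prime_of_mem_primesLE hp).pos
          nlinarith
        have hlt' : (n : ℝ) / p ≤ 2 * (n / p : ℕ) := by
          rw [div_le_iff₀' hp0]
          exact_mod_cast hlt
        rw [Real.log_pow, mul_div_left_comm, ← mul_assoc, mul_comm]
        gcongr
    _ ≤ n * (2 * Real.log n) := by linarith

theorem totient_mul_card_primes_le_card_NNset {g Q a b : ℕ} (hg : g ≠ 0) (hQ : Q ≠ 0)
    (ha : Nat.Coprime a Q) (hb : Nat.Coprime g b) :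
    g.totient * #{p ∈ (2 * Q).primesLE | ¬ p ∣ Q} ≤ #(NNset (g * a) b (g * Q)) := by
  have hex : ∀ p, ∃ v, p.Prime → ¬ p ∣ Q →
      v * a ≡ p * b [MOD Q] ∧ ∀ k, Nat.Coprime g k → Nat.Coprime (v + Q * k) g := by
    intro p
    by_cases hp : p.Prime ∧ ¬ p ∣ Q
    swap
    · exact ⟨0, fun h h' => absurd ⟨h, h'⟩ hp⟩
    obtain ⟨w, hw0, hw⟩ := Nat.chineseRemainder ha 0 (p * b)
    obtain ⟨u, rfl⟩ := (Nat.modEq_zero_iff_dvd.1 hw0)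
    obtain ⟨v, hvu, hv⟩ := exists_modEq_forall_coprime (Q := Q) (u := u) hg
      fun r hr hrg hrQ hru => by
        rcases hr.dvd_mul.1 ((hw.dvd_iff hrQ).1 (hru.mul_left a)) with h | h
        · exact hp.2 (((Nat.prime_dvd_prime_iff_eq hr hp.1).1 h) ▸ hrQ)
        · exact Nat.not_coprime_of_dvd_of_dvd hr.one_lt hrg h hb
    refine ⟨v, fun _ _ => ⟨?_, hv⟩⟩
    exact (hvu.mul_right a).trans (by rwa [mul_comm])
  choose v hv using hex
  have hex' : ∀ x : ℕ × ℕ, ∃ B, x.1.Prime → ¬ x.1 ∣ Q → Nat.Coprime g x.2 →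
      B ∈ Icc 1 (2 * (g * Q)) ∧ B ≡ v x.1 + Q * x.2 [MOD g * Q] ∧
        Nat.Coprime (g * x.1) B := by
    intro x
    by_cases hx : x.1.Prime ∧ ¬ x.1 ∣ Q ∧ Nat.Coprime g x.2
    swap
    · exact ⟨0, fun h h' h'' => absurd ⟨h, h', h''⟩ hx⟩
    obtain ⟨B, hB⟩ := exists_modEq_mem_Icc_coprime (mul_ne_zero hg hQ) (dvd_mul_right g Q) hx.1
      (fun h => (hx.1.dvd_mul.1 h).resolve_right hx.2.1) ((hv x.1 hx.1 hx.2.1).2 x.2 hx.2.2)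
    exact ⟨B, fun _ _ _ => hB⟩
  choose B hB using hex'
  rw [mul_comm, Nat.totient_eq_card_coprime, ← card_product]
  refine card_le_card_of_injOn (fun x => (g * x.1, B x)) ?_ ?_
  · intro x hx
    simp only [coe_product, Set.mem_prod, mem_coe, mem_filter, Nat.mem_primesLE] at hx
    obtain ⟨⟨⟨hp2, hp⟩, hpQ⟩, -, hk⟩ := hx
    obtain ⟨hBm, hBx, hBc⟩ := hB x hp hpQ hk
    simp only [NNset, mem_coe, mem_filter, mem_product, mem_Icc]
    refine ⟨⟨⟨Nat.mul_pos (by lia) hp.pos, by nlinarith⟩, mem_Icc.1 hBm⟩, hBc, ?_⟩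
    have h1 : B x * a ≡ x.1 * b [MOD Q] := by
      refine (Nat.ModEq.mul_right a ?_).trans (hv x.1 hp hpQ).1
      exact (hBx.of_dvd (dvd_mul_left Q g)).trans (by simp [Nat.ModEq])
    obtain ⟨c, hc⟩ := Nat.modEq_iff_dvd.1 h1
    refine ⟨c, ?_⟩
    push_cast at hc ⊢
    linear_combination (g : ℤ) * hc
  · rintro ⟨p, k⟩ hx ⟨p', k'⟩ hx' h
    simp only [coe_product, Set.mem_prod, mem_coe, mem_filter, Nat.mem_primesLE, mem_range]
      at hx hx'
    obtain ⟨⟨⟨hp2, hp⟩, hpQ⟩, hkg, hk⟩ := hx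
    obtain ⟨-, hkg', hk'⟩ := hx'
    simp only [Prod.mk.injEq] at h
    obtain rfl := Nat.eq_of_mul_eq_mul_left (by lia) h.1
    have h1 := (hB (p, k) hp hpQ hk).2.1
    rw [h.2] at h1
    have h2 := Nat.ModEq.add_left_cancel' _ (h1.symm.trans (hB (p, k') hp hpQ hk').2.1)
    dsimp only at h2
    rw [mul_comm g Q] at h2
    have h3 := Nat.ModEq.mul_left_cancel' hQ h2
    rw [Prod.mk.injEq]
    exact ⟨rfl, h3.eq_of_lt_of_lt hkg hkg'⟩

theorem card_primeFactors_mul_log_two_le (n : ℕ) :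
    (#n.primeFactors : ℝ) * Real.log 2 ≤ Real.log n := by
  rcases Nat.eq_zero_or_pos n with rfl | hn
  · simp
  rw [← Real.log_pow]
  refine Real.log_le_log (by positivity) ?_
  have h := (pow_card_le_prod n.primeFactors id 2
    fun p hp => (Nat.prime_of_mem_primeFactors hp).two_le).trans
      (Nat.le_of_dvd hn (Nat.prod_primeFactors_dvd n))
  exact_mod_cast h

theorem totient_mul_le_totient_mul (m n : ℕ) : (m * n).totient ≤ m.totient * n := by
  rcases Nat.eq_zero_or_pos m with rfl | hm
  · simp
  rcases Nat.eq_zero_or_pos n with rfl | hn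
  · simp
  have h : ((m * n).totient : ℚ) ≤ m.totient * n := by
    rw [Nat.totient_eq_mul_prod_factors, Nat.totient_eq_mul_prod_factors, Nat.cast_mul,
      mul_right_comm]
    refine mul_le_mul_of_nonneg_right (mul_le_mul_of_nonneg_left ?_ m.cast_nonneg) n.cast_nonneg
    refine prod_le_prod_of_subset_of_le_one
      (Nat.primeFactors_mono (dvd_mul_right m n) (by positivity)) (fun p _ => ?_) fun p _ _ => ?_
    · exact sub_nonneg.2 (Nat.cast_inv_le_one p)
    · exact sub_le_self _ (by positivity)
  exact_mod_cast h

open Filter Topology in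
theorem exists_mul_le_card_primes_mul_log :
    ∃ c > (0 : ℝ), ∀ Q : ℕ, Q ≠ 0 →
      c * Q ≤ #{p ∈ (2 * Q).primesLE | ¬ p ∣ Q} * Real.log (2 * Q) := by
  have hlarge : ∀ᶠ Q : ℕ in atTop,
      (Q : ℝ) ≤ #{p ∈ (2 * Q).primesLE | ¬ p ∣ Q} * Real.log (2 * Q) := by
    have ht : Tendsto (fun Q : ℕ => 2 * (Q : ℝ)) atTop atTop :=
      tendsto_natCast_atTop_atTop.const_mul_atTop two_pos
    have ho := ht.eventually ((Real.isLittleO_pow_log_id_atTop (n := 2)).bound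
      (show (0 : ℝ) < 1 / 32 by norm_num))
    filter_upwards [ho, eventually_ge_atTop 16] with Q hQ hQ16
    have hQ16' : (16 : ℝ) ≤ Q := by exact_mod_cast hQ16
    simp only [id, Real.norm_eq_abs, abs_pow, sq_abs] at hQ
    rw [abs_of_nonneg (by positivity)] at hQ
    set L := Real.log (2 * Q) with hL
    have hLpos : 0 < L := Real.log_pos (by linarith)
    have hcard : ((2 * Q).primeCounting : ℝ) ≤
        #{p ∈ (2 * Q).primesLE | ¬ p ∣ Q} + #Q.primeFactors := by
      rw [← Nat.primesLE_card_eq_primeCounting]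
      norm_cast
      refine (card_le_card fun p hp => ?_).trans (card_union_le _ _)
      by_cases hpQ : p ∣ Q
      · exact mem_union_right _ (Nat.mem_primeFactors.2
          ⟨Nat.prime_of_mem_primesLE hp, hpQ, by lia⟩)
      · exact mem_union_left _ (mem_filter.2 ⟨hp, hpQ⟩)
    have hpi := Chebyshev.pi_ge (2 * Q)
    push_cast at hpi
    rw [← hL, div_le_iff₀ hLpos] at hpi
    have hlog2 : 0.6931471803 < Real.log 2 := Real.log_two_gt_d9
    have hω : (#Q.primeFactors : ℝ) ≤ 2 * L := by
      have h1 := card_primeFactors_mul_log_two_le Q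
      have h2 : Real.log Q ≤ L := Real.log_le_log (by linarith) (by linarith)
      have h3 : (0 : ℝ) ≤ #Q.primeFactors := by positivity
      nlinarith
    have hsucc : Real.log (2 * Q + 1) ≤ L + 1 := by
      have h := Real.log_mul (x := 2 * Q) (by positivity) (Real.exp_pos 1).ne'
      rw [Real.log_exp] at h
      rw [← h]
      refine Real.log_le_log (by positivity) ?_
      nlinarith [Real.add_one_le_exp (1 : ℝ)]
    have h4 := mul_le_mul_of_nonneg_right hcard hLpos.le
    have h5 := mul_le_mul_of_nonneg_right hω hLpos.le
    nlinarith [sq_nonneg (L - 1)]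
  obtain ⟨N, hN⟩ := eventually_atTop.1 hlarge
  refine ⟨1 / (2 * (N + 1)), by positivity, fun Q hQ => ?_⟩
  have hQ1 : (1 : ℝ) ≤ Q := by exact_mod_cast Nat.one_le_iff_ne_zero.2 hQ
  rw [div_mul_eq_mul_div, one_mul, div_le_iff₀ (by positivity)]
  have hN0 : (0 : ℝ) ≤ N := N.cast_nonneg
  rcases le_total N Q with h | h
  · nlinarith [hN Q h]
  · obtain ⟨p, hp, hQp, hp2⟩ := Nat.exists_prime_lt_and_le_two_mul Q hQ
    have hmem : p ∈ {p ∈ (2 * Q).primesLE | ¬ p ∣ Q} := mem_filter.2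
      ⟨Nat.mem_primesLE.2 ⟨hp2, hp⟩, fun hd => absurd (Nat.le_of_dvd (by lia) hd) (by lia)⟩
    have h1 : (1 : ℝ) ≤ #{p ∈ (2 * Q).primesLE | ¬ p ∣ Q} := by
      exact_mod_cast card_pos.2 ⟨p, hmem⟩
    have h2 : 1 / 2 ≤ Real.log (2 * Q) := by
      have := Real.log_le_log two_pos (show (2 : ℝ) ≤ 2 * Q by linarith)
      linarith [Real.log_two_gt_d9]
    have h3 : (Q : ℝ) ≤ N := by exact_mod_cast h
    nlinarith [mul_le_mul h1 h2 (by norm_num) (by linarith)]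

theorem sum_rpow_neg_le {ε : ℝ} (hε : 0 < ε) (N : ℕ) :
    ∑ n ∈ Icc 1 N, (n : ℝ) ^ (-(1 + ε)) ≤ 1 + ε⁻¹ := by
  rcases Nat.eq_zero_or_pos N with rfl | hN
  · simp; positivity
  suffices h : ∑ n ∈ Icc 1 N, (n : ℝ) ^ (-(1 + ε)) ≤ 1 + ε⁻¹ - ε⁻¹ * (N : ℝ) ^ (-ε) from
    h.trans (sub_le_self _ (by positivity))
  induction N, hN using Nat.le_induction with
  | base => simp
  | succ n hn ih =>
    rw [sum_Icc_succ_top (by lia)]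
    push_cast
    have hx : (0 : ℝ) < n := by exact_mod_cast hn
    have hy : (0 : ℝ) < (n : ℝ) + 1 := by positivity
    set y : ℝ := (n : ℝ) + 1 with hyn
    have ht : y⁻¹ ≤ Real.log y - Real.log n := by
      have h := Real.one_sub_inv_le_log_of_pos (div_pos hy hx)
      rw [Real.log_div hy.ne' hx.ne'] at h
      refine le_trans (le_of_eq ?_) h
      field_simp
      linarith
    have hx' : (n : ℝ) ^ (-ε) = y ^ (-ε) * Real.exp (ε * (Real.log y - Real.log n)) := by
      rw [Real.rpow_def_of_pos hx, Real.rpow_def_of_pos hy, ← Real.exp_add]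
      ring_nf
    have hy' : y ^ (-(1 + ε)) = y ^ (-ε) * y⁻¹ := by
      rw [neg_add_rev, Real.rpow_add hy, Real.rpow_neg_one]
    have hexp : 1 + ε * y⁻¹ ≤ Real.exp (ε * (Real.log y - Real.log n)) := by
      have := Real.add_one_le_exp (ε * (Real.log y - Real.log n))
      nlinarith
    have h : y ^ (-ε) * y⁻¹ ≤ ε⁻¹ * (n : ℝ) ^ (-ε) - ε⁻¹ * y ^ (-ε) := by
      rw [hx', ← mul_sub, ← mul_sub_one, ← div_eq_inv_mul, le_div_iff₀ hε, mul_assoc]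
      gcongr
      linarith
    rw [hy']
    linarith

theorem prod_primeFactors_one_add_rpow_le {q : ℕ} (hq : q ≠ 0) {s : ℝ} :
    ∏ p ∈ q.primeFactors, (1 + (p : ℝ) ^ s) ≤ ∑ n ∈ Icc 1 q, (n : ℝ) ^ s := by
  rw [prod_one_add]
  have hprime : ∀ t ∈ q.primeFactors.powerset, ∀ p ∈ t, p.Prime := fun t ht p hp =>
    Nat.prime_of_mem_primeFactors (mem_powerset.1 ht hp)
  have hinj : Set.InjOn (fun t : Finset ℕ => ∏ p ∈ t, p) q.primeFactors.powerset := by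
    intro t ht t' ht' h
    rw [← Nat.primeFactors_prod (hprime t ht), ← Nat.primeFactors_prod (hprime t' ht')]
    exact congrArg _ h
  calc ∑ t ∈ q.primeFactors.powerset, ∏ p ∈ t, (p : ℝ) ^ s
      = ∑ t ∈ q.primeFactors.powerset, ((∏ p ∈ t, p : ℕ) : ℝ) ^ s := by
        refine sum_congr rfl fun t _ => ?_
        rw [Nat.cast_prod, Real.finsetProd_rpow _ _ fun p _ => p.cast_nonneg]
    _ = ∑ n ∈ q.primeFactors.powerset.image (fun t => ∏ p ∈ t, p), (n : ℝ) ^ s :=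
        (sum_image (f := fun n : ℕ => (n : ℝ) ^ s) hinj).symm
    _ ≤ ∑ n ∈ Icc 1 q, (n : ℝ) ^ s := by
        refine sum_le_sum_of_subset_of_nonneg (fun n hn => ?_) fun n _ _ => by positivity
        obtain ⟨t, ht, rfl⟩ := mem_image.1 hn
        refine mem_Icc.2 ⟨prod_pos fun p hp => (hprime t ht p hp).pos, ?_⟩
        exact Nat.le_of_dvd (by lia)
          ((prod_dvd_prod_of_subset _ _ _ (mem_powerset.1 ht)).trans q.prod_primeFactors_dvd)

theorem half_le_prod_one_sub_inv_sq {s : Finset ℕ} (hs : ∀ n ∈ s, 2 ≤ n) :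
    (1 / 2 : ℝ) ≤ ∏ n ∈ s, (1 - ((n : ℝ) ^ 2)⁻¹) := by
  have hprod : ∀ N : ℕ, 1 ≤ N →
      ∏ n ∈ Icc 2 N, (1 - ((n : ℝ) ^ 2)⁻¹) = ((N : ℝ) + 1) / (2 * N) := by
    intro N hN
    induction N, hN using Nat.le_induction with
    | base => norm_num
    | succ n hn ih =>
      have hn' : (0 : ℝ) < n := by exact_mod_cast hn
      rw [prod_Icc_succ_top (by lia), ih]
      push_cast
      field_simp
      ring
  have hsub : s ⊆ Icc 2 (s.sup id + 1) := fun n hn =>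
    mem_Icc.2 ⟨hs n hn, (le_sup (f := id) hn).trans (Nat.le_succ _)⟩
  have hle : ∏ n ∈ Icc 2 (s.sup id + 1), (1 - ((n : ℝ) ^ 2)⁻¹) ≤
      ∏ n ∈ s, (1 - ((n : ℝ) ^ 2)⁻¹) := by
    refine prod_le_prod_of_subset_of_le_one hsub (fun n hn => sub_nonneg.2 ?_) fun n _ _ =>
      sub_le_self _ (by positivity)
    have : (2 : ℝ) ≤ n := by exact_mod_cast (mem_Icc.1 hn).1
    exact inv_le_one_of_one_le₀ (by nlinarith)
  refine le_trans ?_ hle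
  rw [hprod _ (by lia), le_div_iff₀ (by positivity)]
  linarith

theorem sum_primeFactors_log_div_le {q : ℕ} (hq : 1 < Real.log q) :
    ∑ p ∈ q.primeFactors, Real.log p / p ≤ 2 * Real.log (Real.log q) + 1 := by
  have hq0 : q ≠ 0 := by rintro rfl; norm_num at hq
  have hpos : ∀ p ∈ q.primeFactors, (0 : ℝ) < p := fun p hp => by
    exact_mod_cast (Nat.prime_of_mem_primeFactors hp).pos
  set y := ⌊Real.log q⌋₊
  have hsmall : ∑ p ∈ q.primeFactors with p ∈ y.primesLE, Real.log p / p ≤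
      2 * Real.log (Real.log q) := by
    refine (sum_le_sum_of_subset_of_nonneg (fun p hp => (mem_filter.1 hp).2)
      fun p _ _ => div_nonneg (Real.log_natCast_nonneg p) p.cast_nonneg).trans
      ((sum_log_div_primesLE_le y).trans ?_)
    have : 1 ≤ y := Nat.le_floor (by simpa using hq.le)
    gcongr
    exact Nat.floor_le (by linarith)
  have hlarge : ∑ p ∈ q.primeFactors with p ∉ y.primesLE, Real.log p / p ≤ 1 := by
    calc ∑ p ∈ q.primeFactors with p ∉ y.primesLE, Real.log p / p
        ≤ ∑ p ∈ q.primeFactors with p ∉ y.primesLE, Real.log p / Real.log q := by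
          refine sum_le_sum fun p hp => ?_
          obtain ⟨hp, hpy⟩ := mem_filter.1 hp
          have hyp : y < p := by
            by_contra! h
            exact hpy (Nat.mem_primesLE.2 ⟨h, Nat.prime_of_mem_primeFactors hp⟩)
          have := (Nat.floor_lt (by linarith)).1 hyp
          gcongr
      _ ≤ ∑ p ∈ q.primeFactors, Real.log p / Real.log q :=
          sum_le_sum_of_subset_of_nonneg (filter_subset _ _) fun p _ _ =>
            div_nonneg (Real.log_natCast_nonneg p) (by linarith)
      _ ≤ 1 := by
          rw [← sum_div, div_le_one (by linarith), ← Real.log_prod fun p hp => (hpos p hp).ne']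
          refine Real.log_le_log (prod_pos hpos) ?_
          rw [← Nat.cast_prod]
          exact_mod_cast Nat.le_of_dvd (by lia) q.prod_primeFactors_dvd
  rw [← sum_filter_add_sum_filter_not q.primeFactors (· ∈ y.primesLE)]
  linarith

theorem one_add_inv_le_mul_exp {x : ℝ} (hx : 0 < x) {ε : ℝ} (h0 : 0 ≤ ε * (Real.log x / x)) :
    1 + x⁻¹ ≤ (1 + x ^ (-(1 + ε))) * Real.exp (ε * (Real.log x / x)) := by
  have h1 : x⁻¹ - ε * (Real.log x / x) ≤ x ^ (-(1 + ε)) := by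
    rw [neg_add, Real.rpow_add hx, Real.rpow_neg_one, Real.rpow_def_of_pos hx]
    have := Real.add_one_le_exp (Real.log x * -ε)
    calc x⁻¹ - ε * (Real.log x / x) = x⁻¹ * (Real.log x * -ε + 1) := by ring
      _ ≤ _ := by gcongr
  have h2 := Real.add_one_le_exp (ε * (Real.log x / x))
  have h3 : 0 ≤ x ^ (-(1 + ε)) := by positivity
  nlinarith

theorem le_totient_mul_log_log {q : ℕ} (hq : 1 ≤ Real.log (Real.log q)) :
    (q : ℝ) ≤ 4 * Real.exp 3 * (q.totient * Real.log (Real.log q)) := by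
  set L := Real.log (Real.log q)
  have hq1 : 1 < Real.log q := by
    by_contra! h
    rcases Nat.eq_zero_or_pos q with rfl | h0
    · norm_num [L] at hq
    · linarith [Real.log_nonpos (Real.log_natCast_nonneg q) h]
  have hq0 : q ≠ 0 := by rintro rfl; norm_num at hq1
  have hprime : ∀ p ∈ q.primeFactors, p.Prime := fun p => Nat.prime_of_mem_primeFactors
  have htot : (q.totient : ℝ) = q * ∏ p ∈ q.primeFactors, (1 - (p : ℝ)⁻¹) := by
    have h := congrArg (Rat.cast : ℚ → ℝ) (Nat.totient_eq_mul_prod_factors q)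
    push_cast at h
    exact h
  have hupper : ∏ p ∈ q.primeFactors, (1 + (p : ℝ)⁻¹) ≤ 2 * L * Real.exp 3 := by
    calc ∏ p ∈ q.primeFactors, (1 + (p : ℝ)⁻¹)
        ≤ ∏ p ∈ q.primeFactors,
            ((1 + (p : ℝ) ^ (-(1 + L⁻¹))) * Real.exp (L⁻¹ * (Real.log p / p))) := by
          refine prod_le_prod (fun p _ => by positivity) fun p hp => one_add_inv_le_mul_exp ?_ ?_
          · exact_mod_cast (hprime p hp).pos
          · exact mul_nonneg (by positivity)
              (div_nonneg (Real.log_natCast_nonneg p) p.cast_nonneg)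
      _ = (∏ p ∈ q.primeFactors, (1 + (p : ℝ) ^ (-(1 + L⁻¹)))) *
            Real.exp (L⁻¹ * ∑ p ∈ q.primeFactors, Real.log p / p) := by
          rw [prod_mul_distrib, ← Real.exp_sum, mul_sum]
      _ ≤ (2 * L) * Real.exp 3 := by
          gcongr
          · refine (prod_primeFactors_one_add_rpow_le hq0).trans
              ((sum_rpow_neg_le (by positivity) q).trans ?_)
            rw [inv_inv]
            linarith
          · rw [inv_mul_le_iff₀ (by positivity)]
            linarith [sum_primeFactors_log_div_le hq1]
  have hlower : (1 / 2 : ℝ) ≤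
      (∏ p ∈ q.primeFactors, (1 - (p : ℝ)⁻¹)) * ∏ p ∈ q.primeFactors, (1 + (p : ℝ)⁻¹) := by
    rw [← prod_mul_distrib]
    refine (half_le_prod_one_sub_inv_sq fun p hp => (hprime p hp).two_le).trans (le_of_eq ?_)
    refine prod_congr rfl fun p _ => ?_
    rw [← inv_pow]
    ring
  have hnonneg : 0 ≤ ∏ p ∈ q.primeFactors, (1 - (p : ℝ)⁻¹) :=
    prod_nonneg fun p _ => sub_nonneg.2 (Nat.cast_inv_le_one p)
  have hmul := hlower.trans (mul_le_mul_of_nonneg_left hupper hnonneg)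
  rw [htot]
  have := mul_le_mul_of_nonneg_left hmul q.cast_nonneg
  linarith

end NNsetBound

/-- Lemma 4.2: there are `c > 0` and `q₀` such that for every `q ≥ q₀` and all
`1 ≤ a, b ≤ q` with `gcd(a,b,q) = 1` one has `#𝒩_{a,b,q} ≥ c φ(q)/ln q`; in particular
`#𝒩_{a,b,q} ≥ c' q/(ln q · ln ln q)` for an absolute constant `c' > 0`. -/
theorem NNset_card_lower_bound :
    ∃ c > (0 : ℝ), ∃ c' > (0 : ℝ), ∃ q0 : ℕ, ∀ q : ℕ, q0 ≤ q → ∀ a b : ℕ,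
      1 ≤ a → a ≤ q → 1 ≤ b → b ≤ q → Nat.gcd a (Nat.gcd b q) = 1 →
      c * (Nat.totient q : ℝ) / Real.log q ≤ ((NNset a b q).card : ℝ) ∧
      c' * (q : ℝ) / (Real.log q * Real.log (Real.log q)) ≤ ((NNset a b q).card : ℝ) := by
  obtain ⟨c, hc, hprimes⟩ := exists_mul_le_card_primes_mul_log
  refine ⟨c / 2, by positivity, c / 2 / (4 * Real.exp 3), by positivity,
    ⌈Real.exp (Real.exp 1)⌉₊, fun q hq a b ha haq hb hbq hgcd => ?_⟩
  have hexp : Real.exp (Real.exp 1) ≤ q := (Nat.le_ceil _).trans (by exact_mod_cast hq)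
  have hlog : Real.exp 1 ≤ Real.log q :=
    (Real.le_log_iff_exp_le ((Real.exp_pos _).trans_le hexp)).2 hexp
  have hL : 1 ≤ Real.log (Real.log q) :=
    (Real.le_log_iff_exp_le ((Real.exp_pos _).trans_le hlog)).2 hlog
  have hlogpos : 0 < Real.log q := (Real.exp_pos _).trans_le hlog
  have hq2 : (2 : ℝ) ≤ q := by
    have := Real.add_one_le_exp (1 : ℝ)
    have := Real.add_one_le_exp (Real.exp 1)
    linarith
  have hfirst : c / 2 * (q.totient : ℝ) / Real.log q ≤ (NNset a b q).card := by
    obtain ⟨g, a', Q, hg, hco, rfl, rfl⟩ := Nat.exists_coprime' (m := a) (n := q)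
      (Nat.gcd_pos_of_pos_left q (by lia))
    rw [mul_comm a' g, mul_comm Q g] at *
    have hQ0 : Q ≠ 0 := by rintro rfl; norm_num at hq2
    have hgb : Nat.Coprime g b := Nat.dvd_one.1 <| hgcd ▸
      Nat.dvd_gcd ((Nat.gcd_dvd_left g b).mul_right a') (Nat.dvd_gcd (Nat.gcd_dvd_right g b)
        ((Nat.gcd_dvd_left g b).mul_right Q))
    obtain ⟨k, hk, hN⟩ : ∃ k : ℕ, c * Q ≤ k * Real.log (2 * Q) ∧
        g.totient * k ≤ (NNset (g * a') b (g * Q)).card :=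
      ⟨_, hprimes Q hQ0, totient_mul_card_primes_le_card_NNset hg.ne' hQ0 hco hgb⟩
    have hφ : ((g * Q).totient : ℝ) ≤ g.totient * Q := by
      exact_mod_cast totient_mul_le_totient_mul g Q
    have hlogQ : Real.log (2 * Q) ≤ 2 * Real.log (g * Q : ℕ) := by
      have hQ1 : (0 : ℝ) < Q := by positivity
      have hQq : (Q : ℝ) ≤ (g * Q : ℕ) := by exact_mod_cast Nat.le_mul_of_pos_left Q hg
      rw [two_mul (Real.log _), ← Real.log_mul (by linarith) (by linarith)]
      exact Real.log_le_log (by positivity) (by gcongr)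
    rw [div_le_iff₀ hlogpos]
    calc c / 2 * ((g * Q).totient : ℝ) ≤ c / 2 * (g.totient * Q) := by gcongr
      _ = g.totient * (c * Q) / 2 := by ring
      _ ≤ g.totient * (k * (2 * Real.log (g * Q : ℕ))) / 2 := by
        gcongr (g.totient : ℝ) * ?_ / 2
        exact hk.trans (by gcongr)
      _ = (g.totient * k : ℕ) * Real.log (g * Q : ℕ) := by push_cast; ring
      _ ≤ _ := by gcongr
  refine ⟨hfirst, le_trans ?_ hfirst⟩
  have hLpos : 0 < Real.log (Real.log q) := by linarith
  rw [mul_comm (Real.log q), ← div_div, div_le_div_iff_of_pos_right hlogpos, div_le_iff₀ hLpos,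
    div_mul_eq_mul_div, div_le_iff₀ (by positivity), mul_assoc, mul_assoc]
  gcongr
  linarith [le_totient_mul_log_log hL]
end
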